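/- arXiv:math/0311269 — 3 statements merged into one kernel-verified Lean document; each statement's English description precedes it below -/
import Mathlib

section
/- Let A ⊆ ℝ^M be closed and nonempty (possibly unbounded), and assume the set D(x) := {(f(x,a), ℓ(x,a)) : a ∈ A} is convex for every x ∈ ℝ^N, so that controls are measurable functions α : [0,∞) → A. Assume T ⊆ ℝ^N is closed and nonempty with (STCT); f : ℝ^N × A → ℝ^N is continuous and uniformly Lipschitz in x; ℓ : ℝ^N × A → [0,∞) is continuous; the positivity hypothesis (H5) and the affordability hypothesis (H6) hold; f is bounded on B_R(0) × A for each R > 0; there is a modulus ω with |ℓ(x,u) − ℓ(y,u)| ≤ ω(‖x − y‖) for all x, y ∈ ℝ^N and u ∈ A; sup{ℓ(0,u) : u ∈ A} < ∞; and the set {(f(·,u), ℓ(·,u)) : u ∈ A} is closed in C(ℝ^N, ℝ^N × ℝ) with the topology of compact convergence. If w : ℝ^N → ℝ is continuous, bounded from below, vanishes on T, and is a viscosity solution of sup_{a ∈ A} { −f(x,a)·Dw(x) − ℓ(x,a) } = 0 on ℝ^N ∖ T, then w ≡ v. -/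
open MeasureTheory Set Filter Topology Metric
open scoped ENNReal

noncomputable section

/-- An admissible (ordinary) control: a measurable function valued in `A`. -/
def IsControl {M : ℕ} (A : Set (EuclideanSpace ℝ (Fin M)))
    (α : ℝ → EuclideanSpace ℝ (Fin M)) : Prop :=
  Measurable α ∧ ∀ t, α t ∈ A

/-- `y` is the trajectory of `ẏ = f(y, α)` with `y 0 = x` (integral form). -/
def IsTrajectoryU {N M : ℕ}
    (f : EuclideanSpace ℝ (Fin N) → EuclideanSpace ℝ (Fin M) → EuclideanSpace ℝ (Fin N))
    (α : ℝ → EuclideanSpace ℝ (Fin M)) (x : EuclideanSpace ℝ (Fin N))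
    (y : ℝ → EuclideanSpace ℝ (Fin N)) : Prop :=
  y 0 = x ∧ Continuous y ∧
    ∀ t, 0 ≤ t → y t = x + ∫ s in (0:ℝ)..t, f (y s) (α s)

/-- The set of times `t ≥ 0` at which the trajectory `y` lies in the target `T`;
its infimum is the exit time `t_x(α)`, and `t_x(α) < ∞` iff this set is nonempty. -/
def exitTimesU {N : ℕ} (T : Set (EuclideanSpace ℝ (Fin N)))
    (y : ℝ → EuclideanSpace ℝ (Fin N)) : Set ℝ :=
  {t : ℝ | 0 ≤ t ∧ y t ∈ T}

/-- The running cost `∫₀^t ℓ(y(s), α(s)) ds`, as an extended nonnegative real. -/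
def runCostU {N M : ℕ} (ℓ : EuclideanSpace ℝ (Fin N) → EuclideanSpace ℝ (Fin M) → ℝ)
    (α : ℝ → EuclideanSpace ℝ (Fin M)) (y : ℝ → EuclideanSpace ℝ (Fin N)) (t : ℝ) :
    ℝ≥0∞ :=
  ∫⁻ s in Ioc (0:ℝ) t, ENNReal.ofReal (ℓ (y s) (α s))

/-- The value function `v(x)` of the exit time problem, as an extended real
(`+∞` when no admissible control brings `x` to the target in finite time). -/
def valueFnU {N M : ℕ} (A : Set (EuclideanSpace ℝ (Fin M)))
    (T : Set (EuclideanSpace ℝ (Fin N)))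
    (ℓ : EuclideanSpace ℝ (Fin N) → EuclideanSpace ℝ (Fin M) → ℝ)
    (Y : EuclideanSpace ℝ (Fin N) → (ℝ → EuclideanSpace ℝ (Fin M)) → ℝ →
      EuclideanSpace ℝ (Fin N))
    (x : EuclideanSpace ℝ (Fin N)) : EReal :=
  sInf { c : EReal | ∃ α, IsControl A α ∧ (exitTimesU T (Y x α)).Nonempty ∧
      c = ((runCostU ℓ α (Y x α) (sInf (exitTimesU T (Y x α)))) : EReal) }

/-- Viscosity solution of `F(x, Dw(x)) = 0` on the open set `G`, via `C¹` test functions. -/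
def IsViscositySolU {N : ℕ}
    (F : EuclideanSpace ℝ (Fin N) → EuclideanSpace ℝ (Fin N) → ℝ)
    (G : Set (EuclideanSpace ℝ (Fin N))) (w : EuclideanSpace ℝ (Fin N) → ℝ) : Prop :=
  (∀ γ : EuclideanSpace ℝ (Fin N) → ℝ, ContDiffOn ℝ 1 γ G → ∀ x₀ ∈ G,
      IsLocalMinOn (fun x => w x - γ x) G x₀ → 0 ≤ F x₀ (gradient γ x₀)) ∧
  (∀ γ : EuclideanSpace ℝ (Fin N) → ℝ, ContDiffOn ℝ 1 γ G → ∀ x₁ ∈ G,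
      IsLocalMaxOn (fun x => w x - γ x) G x₁ → F x₁ (gradient γ x₁) ≤ 0)

/-- Standing hypotheses. -/
structure HypU {N M : ℕ} (A : Set (EuclideanSpace ℝ (Fin M)))
    (f : EuclideanSpace ℝ (Fin N) → EuclideanSpace ℝ (Fin M) → EuclideanSpace ℝ (Fin N))
    (ℓ : EuclideanSpace ℝ (Fin N) → EuclideanSpace ℝ (Fin M) → ℝ)
    (Y : EuclideanSpace ℝ (Fin N) → (ℝ → EuclideanSpace ℝ (Fin M)) → ℝ →
      EuclideanSpace ℝ (Fin N)) (L C0 C1 : ℝ) (ω : ℝ → ℝ) : Prop where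
  ne : A.Nonempty
  cl : IsClosed A
  hf : ContinuousOn (fun q : EuclideanSpace ℝ (Fin N) × EuclideanSpace ℝ (Fin M) =>
      f q.1 q.2) (univ ×ˢ A)
  hL : 0 < L
  hfLip : ∀ x y, ∀ a ∈ A, ‖f x a - f y a‖ ≤ L * ‖x - y‖
  hℓ : ContinuousOn (fun q : EuclideanSpace ℝ (Fin N) × EuclideanSpace ℝ (Fin M) =>
      ℓ q.1 q.2) (univ ×ˢ A)
  hℓnn : ∀ x, ∀ a ∈ A, 0 ≤ ℓ x a
  hY : ∀ x α, IsControl A α → IsTrajectoryU f α x (Y x α)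
  hωc : Continuous ω
  hωmono : Monotone ω
  hω0 : ω 0 = 0
  hH8 : ∀ x y, ∀ u ∈ A, |ℓ x u - ℓ y u| ≤ ω ‖x - y‖
  hC0 : ∀ a ∈ A, ‖f 0 a‖ ≤ C0
  hC1 : ∀ a ∈ A, ℓ 0 a ≤ C1

/-- Real-valued cost. -/
def costU {N M : ℕ} (ℓ : EuclideanSpace ℝ (Fin N) → EuclideanSpace ℝ (Fin M) → ℝ)
    (Y : EuclideanSpace ℝ (Fin N) → (ℝ → EuclideanSpace ℝ (Fin M)) → ℝ →
      EuclideanSpace ℝ (Fin N)) (x : EuclideanSpace ℝ (Fin N))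
    (α : ℝ → EuclideanSpace ℝ (Fin M)) (t : ℝ) : ℝ :=
  ∫ s in (0:ℝ)..t, ℓ (Y x α s) (α s)

/-- Integral form of Gronwall's inequality. -/
lemma gronwall_int {u : ℝ → ℝ} (hu : Continuous u) {a L τ : ℝ} (hL : 0 < L)
    (h : ∀ t ∈ Icc 0 τ, u t ≤ a + L * ∫ s in (0:ℝ)..t, u s) :
    ∀ t ∈ Icc 0 τ, u t ≤ a * Real.exp (L * t) := by
  intro t ht
  have hd : ∀ s, HasDerivAt (fun t => ∫ s in (0:ℝ)..t, u s) (u s) s := fun s =>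
    hu.integral_hasStrictDerivAt 0 s |>.hasDerivAt
  have hg : ∀ s, HasDerivAt (fun t => (a / L + ∫ s in (0:ℝ)..t, u s) * Real.exp (-(L * t)))
      (u s * Real.exp (-(L * s)) + (a / L + ∫ s in (0:ℝ)..s, u s) *
        (Real.exp (-(L * s)) * (-(L * 1)))) s := by
    intro s
    have h1 : HasDerivAt (fun t => Real.exp (-(L * t))) (Real.exp (-(L * s)) * (-(L * 1))) s :=
      (((hasDerivAt_id s).const_mul L).neg).exp
    exact ((hd s).const_add _).mul h1
  have hanti : AntitoneOn (fun t => (a / L + ∫ s in (0:ℝ)..t, u s) * Real.exp (-(L * t)))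
      (Icc 0 τ) := by
    apply antitoneOn_of_deriv_nonpos (convex_Icc _ _)
    · exact fun s _ => (hg s).continuousAt.continuousWithinAt
    · exact fun s _ => (hg s).differentiableAt.differentiableWithinAt
    · intro s hs
      rw [interior_Icc] at hs
      rw [(hg s).deriv]
      have := h s ⟨hs.1.le, hs.2.le⟩
      have he := Real.exp_pos (-(L * s))
      have h2 : u s * Real.exp (-(L * s)) + (a / L + ∫ s in (0:ℝ)..s, u s) *
        (Real.exp (-(L * s)) * (-(L * 1))) =
        (u s - (a + L * ∫ s in (0:ℝ)..s, u s)) * Real.exp (-(L * s)) := by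
        field_simp; ring
      rw [h2]
      exact mul_nonpos_of_nonpos_of_nonneg (by linarith) he.le
  have h3 := hanti ⟨le_refl 0, ht.1.trans ht.2⟩ ht ht.1
  simp only [intervalIntegral.integral_same, mul_zero, neg_zero, Real.exp_zero] at h3
  have he := Real.exp_pos (L * t)
  have h4 : (a / L + ∫ s in (0:ℝ)..t, u s) ≤ a / L * Real.exp (L * t) := by
    rw [Real.exp_neg] at h3
    have := mul_le_mul_of_nonneg_right h3 he.le
    rw [mul_assoc, inv_mul_cancel₀ he.ne'] at this
    linarith
  calc u t ≤ a + L * ∫ s in (0:ℝ)..t, u s := h t ht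
    _ = L * (a / L + ∫ s in (0:ℝ)..t, u s) := by field_simp
    _ ≤ L * (a / L * Real.exp (L * t)) := by gcongr
    _ = _ := by field_simp

namespace HypU

variable {N M : ℕ} {A : Set (EuclideanSpace ℝ (Fin M))}
    {f : EuclideanSpace ℝ (Fin N) → EuclideanSpace ℝ (Fin M) → EuclideanSpace ℝ (Fin N)}
    {ℓ : EuclideanSpace ℝ (Fin N) → EuclideanSpace ℝ (Fin M) → ℝ}
    {Y : EuclideanSpace ℝ (Fin N) → (ℝ → EuclideanSpace ℝ (Fin M)) → ℝ →
      EuclideanSpace ℝ (Fin N)} {L C0 C1 : ℝ} {ω : ℝ → ℝ}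

lemma f_le (H : HypU A f ℓ Y L C0 C1 ω) (x) {a} (ha : a ∈ A) : ‖f x a‖ ≤ C0 + L * ‖x‖ := by
  have h1 := H.hfLip x 0 a ha
  have h2 := H.hC0 a ha
  rw [sub_zero] at h1
  have h3 := norm_sub_norm_le (f x a) (f 0 a)
  linarith

lemma l_le (H : HypU A f ℓ Y L C0 C1 ω) (x) {a} (ha : a ∈ A) : ℓ x a ≤ C1 + ω ‖x‖ := by
  have h1 := H.hH8 x 0 a ha
  have h2 := H.hC1 a ha
  rw [sub_zero] at h1
  have := le_abs_self (ℓ x a - ℓ 0 a)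
  linarith

lemma C0_nn (H : HypU A f ℓ Y L C0 C1 ω) : 0 ≤ C0 := by
  obtain ⟨a, ha⟩ := H.ne
  exact (norm_nonneg _).trans (H.hC0 a ha)

lemma C1_nn (H : HypU A f ℓ Y L C0 C1 ω) : 0 ≤ C1 := by
  obtain ⟨a, ha⟩ := H.ne
  exact (H.hℓnn 0 a ha).trans (H.hC1 a ha)

lemma ω_nn (H : HypU A f ℓ Y L C0 C1 ω) {r : ℝ} (hr : 0 ≤ r) : 0 ≤ ω r := by
  rw [← H.hω0]; exact H.hωmono hr

lemma meas_f (H : HypU A f ℓ Y L C0 C1 ω) {α} (hα : IsControl A α) {y} (hy : Measurable y) :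
    Measurable (fun s : ℝ => f (y s) (α s)) := by
  have h1 : Measurable (fun s : ℝ => (⟨(y s, α s), ⟨mem_univ _, hα.2 s⟩⟩ :
      (univ ×ˢ A : Set (EuclideanSpace ℝ (Fin N) × EuclideanSpace ℝ (Fin M))))) :=
    (hy.prodMk hα.1).subtype_mk
  exact (continuousOn_iff_continuous_domRestrict.1 H.hf).measurable.comp h1

lemma meas_l (H : HypU A f ℓ Y L C0 C1 ω) {α} (hα : IsControl A α) {y} (hy : Measurable y) :
    Measurable (fun s : ℝ => ℓ (y s) (α s)) := by
  have h1 : Measurable (fun s : ℝ => (⟨(y s, α s), ⟨mem_univ _, hα.2 s⟩⟩ :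
      (univ ×ˢ A : Set (EuclideanSpace ℝ (Fin N) × EuclideanSpace ℝ (Fin M))))) :=
    (hy.prodMk hα.1).subtype_mk
  exact (continuousOn_iff_continuous_domRestrict.1 H.hℓ).measurable.comp h1

lemma int_f (H : HypU A f ℓ Y L C0 C1 ω) {α} (hα : IsControl A α) {y} (hy : Continuous y)
    (s t : ℝ) : IntervalIntegrable (fun s : ℝ => f (y s) (α s)) volume s t := by
  have h : IntervalIntegrable (fun s => C0 + L * ‖y s‖) volume s t :=
    Continuous.intervalIntegrable (by fun_prop) _ _
  refine h.mono_fun (H.meas_f hα hy.measurable).aestronglyMeasurable ?_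
  exact ae_of_all _ fun r => (H.f_le _ (hα.2 r)).trans (Real.le_norm_self _)

lemma int_l (H : HypU A f ℓ Y L C0 C1 ω) {α} (hα : IsControl A α) {y} (hy : Continuous y)
    (s t : ℝ) : IntervalIntegrable (fun s : ℝ => ℓ (y s) (α s)) volume s t := by
  have h : IntervalIntegrable (fun s => C1 + ω ‖y s‖) volume s t :=
    Continuous.intervalIntegrable (by have := H.hωc; fun_prop) _ _
  refine h.mono_fun (H.meas_l hα hy.measurable).aestronglyMeasurable ?_
  refine ae_of_all _ fun r => ?_
  beta_reduce
  rw [Real.norm_of_nonneg (H.hℓnn _ _ (hα.2 r))]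
  exact (H.l_le _ (hα.2 r)).trans (Real.le_norm_self _)

lemma Y_cont (H : HypU A f ℓ Y L C0 C1 ω) {α} (hα : IsControl A α) (x) : Continuous (Y x α) :=
  (H.hY x α hα).2.1

lemma Y_zero (H : HypU A f ℓ Y L C0 C1 ω) {α} (hα : IsControl A α) (x) : Y x α 0 = x :=
  (H.hY x α hα).1

lemma Y_eq (H : HypU A f ℓ Y L C0 C1 ω) {α} (hα : IsControl A α) (x) {t : ℝ} (ht : 0 ≤ t) :
    Y x α t = x + ∫ s in (0:ℝ)..t, f (Y x α s) (α s) :=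
  (H.hY x α hα).2.2 t ht

lemma uniq (H : HypU A f ℓ Y L C0 C1 ω) {α} (hα : IsControl A α) (x) {y} (hy : Continuous y)
    {τ : ℝ} (h : ∀ t ∈ Icc 0 τ, y t = x + ∫ s in (0:ℝ)..t, f (y s) (α s)) :
    ∀ t ∈ Icc 0 τ, y t = Y x α t := by
  intro t ht
  have hc := H.Y_cont hα x
  have := gronwall_int (u := fun t => ‖y t - Y x α t‖) (by fun_prop) (a := 0) (L := L) (τ := τ)
    H.hL (by
      intro t ht
      rw [h t ht, H.Y_eq hα x ht.1, add_sub_add_left_eq_sub,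
        ← intervalIntegral.integral_sub (H.int_f hα hy _ _) (H.int_f hα hc _ _), zero_add,
        ← intervalIntegral.integral_const_mul]
      refine intervalIntegral.norm_integral_le_of_norm_le ht.1 ?_
        (Continuous.intervalIntegrable (by fun_prop) _ _)
      exact ae_of_all _ fun s _ => H.hfLip _ _ _ (hα.2 s)) t ht
  rw [zero_mul] at this
  exact sub_eq_zero.1 (norm_le_zero_iff.1 this)

lemma Y_bound (H : HypU A f ℓ Y L C0 C1 ω) {α} (hα : IsControl A α) (x) {τ : ℝ} :
    ∀ t ∈ Icc 0 τ, ‖Y x α t‖ ≤ (‖x‖ + C0 * τ) * Real.exp (L * τ) := by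
  intro t ht
  have hc := H.Y_cont hα x
  have hC := H.C0_nn
  have := gronwall_int (u := fun t => ‖Y x α t‖) (by fun_prop) (a := ‖x‖ + C0 * τ) (L := L)
    (τ := τ) H.hL (by
      intro t ht
      have h1 : ‖∫ s in (0:ℝ)..t, f (Y x α s) (α s)‖ ≤ ∫ s in (0:ℝ)..t, (C0 + L * ‖Y x α s‖) := by
        refine intervalIntegral.norm_integral_le_of_norm_le ht.1 ?_
          (Continuous.intervalIntegrable (by fun_prop) _ _)
        exact ae_of_all _ fun s _ => H.f_le _ (hα.2 s)
      rw [intervalIntegral.integral_add (by simp) (Continuous.intervalIntegrable (by fun_prop) _ _),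
        intervalIntegral.integral_const_mul, intervalIntegral.integral_const] at h1
      simp only [sub_zero, smul_eq_mul] at h1
      have h2 : ‖Y x α t‖ ≤ ‖x‖ + ‖∫ s in (0:ℝ)..t, f (Y x α s) (α s)‖ := by
        conv_lhs => rw [H.Y_eq hα x ht.1]
        exact norm_add_le _ _
      have h3 : t * C0 ≤ C0 * τ := by nlinarith [ht.2]
      linarith) t ht
  refine this.trans ?_
  have hτ : 0 ≤ τ := ht.1.trans ht.2
  have hL := H.hL
  gcongr
  exact ht.2

lemma Y_congr (H : HypU A f ℓ Y L C0 C1 ω) {α β} (hα : IsControl A α) (hβ : IsControl A β) (x)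
    {τ : ℝ} (h : ∀ s ∈ Ioc 0 τ, α s = β s) : ∀ t ∈ Icc 0 τ, Y x α t = Y x β t := by
  refine H.uniq hβ x (H.Y_cont hα x) fun t ht => ?_
  conv_lhs => rw [H.Y_eq hα x ht.1]
  congr 1
  refine intervalIntegral.integral_congr_ae (ae_of_all _ fun s hs => ?_)
  rw [uIoc_of_le ht.1] at hs
  simp only [h s ⟨hs.1, hs.2.trans ht.2⟩]

lemma cost_congr (H : HypU A f ℓ Y L C0 C1 ω) {α β} (hα : IsControl A α) (hβ : IsControl A β) (x)
    {τ : ℝ} (h : ∀ s ∈ Ioc 0 τ, α s = β s) : ∀ t ∈ Icc 0 τ, costU ℓ Y x α t = costU ℓ Y x β t := by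
  intro t ht
  refine intervalIntegral.integral_congr_ae (ae_of_all _ fun s hs => ?_)
  rw [uIoc_of_le ht.1] at hs
  have h1 : s ∈ Ioc 0 τ := ⟨hs.1, hs.2.trans ht.2⟩
  simp only [h s h1, H.Y_congr hα hβ x h s ⟨h1.1.le, h1.2⟩]

lemma shift_ctl {α : ℝ → EuclideanSpace ℝ (Fin M)} (hα : IsControl A α) (τ : ℝ) :
    IsControl A (fun s => α (τ + s)) :=
  ⟨hα.1.comp (measurable_const_add τ), fun t => hα.2 _⟩

lemma Y_shift (H : HypU A f ℓ Y L C0 C1 ω) {α} (hα : IsControl A α) (x)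
    {τ t : ℝ} (hτ : 0 ≤ τ) (ht : 0 ≤ t) :
    Y (Y x α τ) (fun s => α (τ + s)) t = Y x α (τ + t) := by
  symm
  have hc := H.Y_cont hα x
  refine H.uniq (shift_ctl hα τ) (Y x α τ) (y := fun s => Y x α (τ + s)) (by fun_prop) (τ := t)
    (fun t ht => ?_) t ⟨ht, le_rfl⟩
  rw [intervalIntegral.integral_comp_add_left (fun s => f (Y x α s) (α s)),
    H.Y_eq hα x (add_nonneg hτ ht.1), add_zero]
  conv_rhs => rw [H.Y_eq hα x hτ]
  rw [add_assoc, intervalIntegral.integral_add_adjacent_intervals (H.int_f hα hc _ _)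
    (H.int_f hα hc _ _)]

lemma cost_shift (H : HypU A f ℓ Y L C0 C1 ω) {α} (hα : IsControl A α) (x)
    {τ t : ℝ} (hτ : 0 ≤ τ) (ht : 0 ≤ t) :
    costU ℓ Y x α (τ + t) = costU ℓ Y x α τ + costU ℓ Y (Y x α τ) (fun s => α (τ + s)) t := by
  have hc := H.Y_cont hα x
  unfold costU
  rw [← intervalIntegral.integral_add_adjacent_intervals (H.int_l hα hc 0 τ)
    (H.int_l hα hc τ (τ + t))]
  congr 1
  have := intervalIntegral.integral_comp_add_left (a := 0) (b := t)
    (fun s => ℓ (Y x α s) (α s)) τ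
  rw [add_zero] at this
  rw [← this]
  refine intervalIntegral.integral_congr fun s hs => ?_
  rw [uIcc_of_le ht] at hs
  simp only [H.Y_shift hα x hτ hs.1]

lemma cost_nn (H : HypU A f ℓ Y L C0 C1 ω) {α} (hα : IsControl A α) (x)
    {t : ℝ} (ht : 0 ≤ t) : 0 ≤ costU ℓ Y x α t :=
  intervalIntegral.integral_nonneg ht fun s _ => H.hℓnn _ _ (hα.2 s)

lemma cost_mono (H : HypU A f ℓ Y L C0 C1 ω) {α} (hα : IsControl A α) (x)
    {s t : ℝ} (hs : 0 ≤ s) (hst : s ≤ t) : costU ℓ Y x α s ≤ costU ℓ Y x α t := by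
  have := H.cost_shift hα x hs (sub_nonneg.2 hst)
  have h2 := H.cost_nn (shift_ctl hα s) (Y x α s) (sub_nonneg.2 hst)
  rw [add_sub_cancel] at this
  linarith

lemma runCost_eq (H : HypU A f ℓ Y L C0 C1 ω) {α} (hα : IsControl A α) (x)
    {t : ℝ} (ht : 0 ≤ t) : runCostU ℓ α (Y x α) t = ENNReal.ofReal (costU ℓ Y x α t) := by
  unfold runCostU costU
  rw [intervalIntegral.integral_of_le ht, ofReal_integral_eq_lintegral_ofReal]
  · exact (intervalIntegrable_iff_integrableOn_Ioc_of_le ht).1 (H.int_l hα (H.Y_cont hα x) 0 t)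
  · exact ae_of_all _ fun s => H.hℓnn _ _ (hα.2 s)

end HypU

/-- Concatenation of controls. -/
def catU {M : ℕ} (α : ℝ → EuclideanSpace ℝ (Fin M)) (τ : ℝ) (β : ℝ → EuclideanSpace ℝ (Fin M)) :
    ℝ → EuclideanSpace ℝ (Fin M) := fun t => if t ≤ τ then α t else β (t - τ)

namespace HypU

variable {N M : ℕ} {A : Set (EuclideanSpace ℝ (Fin M))}
    {f : EuclideanSpace ℝ (Fin N) → EuclideanSpace ℝ (Fin M) → EuclideanSpace ℝ (Fin N)}
    {ℓ : EuclideanSpace ℝ (Fin N) → EuclideanSpace ℝ (Fin M) → ℝ}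
    {Y : EuclideanSpace ℝ (Fin N) → (ℝ → EuclideanSpace ℝ (Fin M)) → ℝ →
      EuclideanSpace ℝ (Fin N)} {L C0 C1 : ℝ} {ω : ℝ → ℝ}

lemma cat_ctl {α β : ℝ → EuclideanSpace ℝ (Fin M)} (hα : IsControl A α) (hβ : IsControl A β)
    (τ : ℝ) : IsControl A (catU α τ β) := by
  constructor
  · exact Measurable.ite measurableSet_Iic hα.1 (hβ.1.comp (measurable_sub_const τ))
  · intro t; unfold catU; split_ifs
    · exact hα.2 _
    · exact hβ.2 _

lemma Y_cat_left (H : HypU A f ℓ Y L C0 C1 ω) {α β} (hα : IsControl A α) (hβ : IsControl A β) (x)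
    {τ : ℝ} : ∀ t ∈ Icc 0 τ, Y x (catU α τ β) t = Y x α t :=
  H.Y_congr (cat_ctl hα hβ τ) hα x fun s hs => by simp [catU, hs.2]

lemma cost_cat_left (H : HypU A f ℓ Y L C0 C1 ω) {α β} (hα : IsControl A α) (hβ : IsControl A β)
    (x) {τ : ℝ} : ∀ t ∈ Icc 0 τ, costU ℓ Y x (catU α τ β) t = costU ℓ Y x α t :=
  H.cost_congr (cat_ctl hα hβ τ) hα x fun s hs => by simp [catU, hs.2]

lemma Y_cat_right (H : HypU A f ℓ Y L C0 C1 ω) {α β} (hα : IsControl A α) (hβ : IsControl A β) (x)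
    {τ t : ℝ} (hτ : 0 ≤ τ) (ht : 0 ≤ t) :
    Y x (catU α τ β) (τ + t) = Y (Y x α τ) β t := by
  rw [← H.Y_shift (cat_ctl hα hβ τ) x hτ ht, H.Y_cat_left hα hβ x τ ⟨hτ, le_rfl⟩]
  exact H.Y_congr (shift_ctl (cat_ctl hα hβ τ) τ) hβ _ (τ := t)
    (fun s hs => by simp [catU, hs.1]) t ⟨ht, le_rfl⟩

lemma cost_cat_right (H : HypU A f ℓ Y L C0 C1 ω) {α β} (hα : IsControl A α) (hβ : IsControl A β)
    (x) {τ t : ℝ} (hτ : 0 ≤ τ) (ht : 0 ≤ t) :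
    costU ℓ Y x (catU α τ β) (τ + t) = costU ℓ Y x α τ + costU ℓ Y (Y x α τ) β t := by
  rw [H.cost_shift (cat_ctl hα hβ τ) x hτ ht, H.cost_cat_left hα hβ x τ ⟨hτ, le_rfl⟩,
    H.Y_cat_left hα hβ x τ ⟨hτ, le_rfl⟩]
  congr 1
  exact H.cost_congr (shift_ctl (cat_ctl hα hβ τ) τ) hβ _ (τ := t)
    (fun s hs => by simp [catU, hs.1]) t ⟨ht, le_rfl⟩

/-- Time-Lipschitz bound. -/
lemma Y_lip (H : HypU A f ℓ Y L C0 C1 ω) {α} (hα : IsControl A α) (x) {τ K : ℝ}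
    (hK : C0 + L * ((‖x‖ + C0 * τ) * Real.exp (L * τ)) ≤ K) {s t : ℝ} (hs : 0 ≤ s)
    (hst : s ≤ t) (ht : t ≤ τ) : ‖Y x α t - Y x α s‖ ≤ K * (t - s) := by
  have hc := H.Y_cont hα x
  rw [H.Y_eq hα x hs, H.Y_eq hα x (hs.trans hst), add_sub_add_left_eq_sub,
    intervalIntegral.integral_interval_sub_left (H.int_f hα hc _ _) (H.int_f hα hc _ _)]
  have := intervalIntegral.norm_integral_le_of_norm_le_const (a := s) (b := t) (C := K)
    (f := fun s => f (Y x α s) (α s)) (fun r hr => by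
      rw [uIoc_of_le hst] at hr
      refine (H.f_le _ (hα.2 r)).trans (le_trans ?_ hK)
      have := H.Y_bound hα x (τ := τ) r ⟨hs.trans hr.1.le, hr.2.trans ht⟩
      have hL := H.hL
      gcongr)
  rwa [abs_of_nonneg (by linarith)] at this

end HypU

/-- Localized inf-convolution. -/
lemma infconvU {N : ℕ} {u : EuclideanSpace ℝ (Fin N) → ℝ} (hu : Continuous u) {R rb δ : ℝ}
    (hR : 0 ≤ R) (hrb : 0 < rb) (hδ : 0 < δ) :
    ∃ ε : ℝ, 0 < ε ∧ ∃ s : EuclideanSpace ℝ (Fin N) → EuclideanSpace ℝ (Fin N),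
      (∀ x s', ‖s'‖ ≤ R + 1 → u (s x) + ‖x - s x‖ ^ 2 / (2 * ε) ≤ u s' + ‖x - s'‖ ^ 2 / (2 * ε)) ∧
      ∀ x, ‖x‖ ≤ R → ‖x - s x‖ ≤ rb ∧ ‖x - s x‖ < 1 ∧ ‖x - s x‖ ^ 2 / ε ≤ δ ∧
        u x ≤ u (s x) + δ ∧ ‖s x‖ < R + 1 := by
  have hK : IsCompact (closedBall (0 : EuclideanSpace ℝ (Fin N)) (R + 1)) := isCompact_closedBall _ _
  have huc := hK.uniformContinuousOn_of_continuous hu.continuousOn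
  rw [Metric.uniformContinuousOn_iff] at huc
  obtain ⟨ρ0, hρ0, huc⟩ := huc (δ / 2) (by positivity)
  obtain ⟨C, hC⟩ := hK.exists_bound_of_continuousOn hu.continuousOn
  set ρ := min ρ0 (min rb 1) with hρ
  have hρpos : 0 < ρ := by positivity
  have hC0 : 0 ≤ C := (norm_nonneg _).trans (hC 0 (by simp; linarith))
  set ε := ρ ^ 2 / (4 * C + 4) with hε
  have hεpos : 0 < ε := by positivity
  have hmin : ∀ x, ∃ s ∈ closedBall (0 : EuclideanSpace ℝ (Fin N)) (R + 1),
      IsMinOn (fun s' => u s' + ‖x - s'‖ ^ 2 / (2 * ε)) (closedBall 0 (R + 1)) s := by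
    intro x
    exact hK.exists_isMinOn ⟨0, by simp; linarith⟩ (by fun_prop)
  choose s hs hsm using hmin
  refine ⟨ε, hεpos, s, fun x s' hs' => hsm x (by simpa using hs'), fun x hx => ?_⟩
  have hxm : x ∈ closedBall (0 : EuclideanSpace ℝ (Fin N)) (R + 1) := by
    simp; linarith
  have h1 : u (s x) + ‖x - s x‖ ^ 2 / (2 * ε) ≤ u x := by
    have := hsm x hxm
    simpa using this
  have h2 := hC x hxm
  have h3 := hC (s x) (hs x)
  rw [Real.norm_eq_abs, abs_le] at h2 h3
  have h4 : ‖x - s x‖ ^ 2 / (2 * ε) ≤ 2 * C := by linarith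
  have h5 : ‖x - s x‖ ^ 2 < ρ ^ 2 := by
    rw [div_le_iff₀ (by positivity)] at h4
    have : (4 * C + 4) * ε = ρ ^ 2 := by rw [hε]; field_simp
    nlinarith
  have h6 : ‖x - s x‖ < ρ := lt_of_pow_lt_pow_left₀ 2 hρpos.le h5
  have h7 := huc x hxm (s x) (hs x) (by rw [dist_eq_norm]; exact h6.trans_le (min_le_left _ _))
  rw [Real.dist_eq, abs_lt] at h7
  have h8 : ‖x - s x‖ < 1 := h6.trans_le ((min_le_right _ _).trans (min_le_right _ _))
  refine ⟨h6.le.trans ((min_le_right _ _).trans (min_le_left _ _)), h8, ?_, by linarith, ?_⟩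
  · have : ‖x - s x‖ ^ 2 / ε = 2 * (‖x - s x‖ ^ 2 / (2 * ε)) := by field_simp
    linarith
  · have : ‖s x‖ ≤ ‖x‖ + ‖x - s x‖ := by
      have := norm_sub_le x (x - s x)
      simpa using this
    linarith

namespace HypU

variable {N M : ℕ} {A : Set (EuclideanSpace ℝ (Fin M))}
    {f : EuclideanSpace ℝ (Fin N) → EuclideanSpace ℝ (Fin M) → EuclideanSpace ℝ (Fin N)}
    {ℓ : EuclideanSpace ℝ (Fin N) → EuclideanSpace ℝ (Fin M) → ℝ}
    {Y : EuclideanSpace ℝ (Fin N) → (ℝ → EuclideanSpace ℝ (Fin M)) → ℝ →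
      EuclideanSpace ℝ (Fin N)} {L C0 C1 : ℝ} {ω : ℝ → ℝ}

set_option maxHeartbeats 800000 in
/-- One-step estimate for the inf-convolution. -/
lemma step (H : HypU A f ℓ Y L C0 C1 ω) {u : EuclideanSpace ℝ (Fin N) → ℝ} (hu : Continuous u)
    {σ : ℝ} (hσ : |σ| ≤ 1) {R rb δ : ℝ} (hR : 0 ≤ R) (hrb : 0 < rb) (hδ : 0 < δ) :
    ∃ ε : ℝ, 0 < ε ∧ ∃ s : EuclideanSpace ℝ (Fin N) → EuclideanSpace ℝ (Fin N),
    ∃ W : EuclideanSpace ℝ (Fin N) → ℝ, ∃ h0 : ℝ, 0 < h0 ∧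
      (∀ x, ‖x‖ ≤ R → W x ≤ u x ∧ u x ≤ W x + δ ∧ ‖x - s x‖ ≤ rb ∧
        IsLocalMin (fun y => u y + ‖x - y‖ ^ 2 / (2 * ε)) (s x)) ∧
      (∀ x, ‖x‖ ≤ R → ∀ α, IsControl A α → ∀ h, 0 < h → h ≤ h0 →
        (∀ r, inner ℝ (f (s x) (α r)) ((1 / ε) • (x - s x)) ≤ σ * ℓ (s x) (α r) + δ / 5) →
        W (Y x α h) ≤ W x + σ * costU ℓ Y x α h + h * δ) := by
  have hL := H.hL
  obtain ⟨ρ, hρ, hωρ⟩ : ∃ ρ : ℝ, 0 < ρ ∧ ω ρ ≤ δ / 5 := by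
    have h1 : Tendsto ω (𝓝 0) (𝓝 0) := by
      have := H.hωc.tendsto 0; rwa [H.hω0] at this
    have h2 : ∀ᶠ r in 𝓝[>] (0:ℝ), ω r < δ / 5 :=
      (h1.eventually (gt_mem_nhds (by positivity))).filter_mono nhdsWithin_le_nhds
    obtain ⟨ρ, h3, h4⟩ := (h2.and self_mem_nhdsWithin).exists
    exact ⟨ρ, h4, h3.le⟩
  obtain ⟨ε, hε, s, hmin, hs⟩ := infconvU hu hR (rb := min rb (ρ / 2)) (δ := min δ (δ / (5 * L)))
    (by positivity) (by positivity)
  have hC0 := H.C0_nn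
  set K := C0 + L * ((R + C0 * 1) * Real.exp (L * 1)) + 1 with hKdef
  have hK : 0 < K := by positivity
  refine ⟨ε, hε, s, fun x => u (s x) + ‖x - s x‖ ^ 2 / (2 * ε),
    min 1 (min (ρ / (2 * K)) (min (δ * ε / (5 * L * K)) (δ * ε / (5 * K ^ 2)))), by positivity,
    fun x hx => ?_, fun x hx α hα h hh hh0 hle => ?_⟩
  · obtain ⟨h1, h2, h3, h4, h5⟩ := hs x hx
    refine ⟨?_, ?_, h1.trans (min_le_left _ _), ?_⟩
    · have := hmin x x (by linarith)
      simpa using this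
    · have : 0 ≤ ‖x - s x‖ ^ 2 / (2 * ε) := by positivity
      have := min_le_left δ (δ / (5 * L))
      simp only
      linarith
    · have : closedBall (0 : EuclideanSpace ℝ (Fin N)) (R + 1) ∈ 𝓝 (s x) :=
        mem_of_superset (isOpen_ball.mem_nhds (by simpa using h5)) ball_subset_closedBall
      filter_upwards [this] with y hy
      exact hmin x y (by simpa using hy)
  · obtain ⟨h1, h2, h3, h4, h5⟩ := hs x hx
    simp only [le_min_iff] at hh0
    obtain ⟨g1, g2, g3, g4⟩ := hh0
    rw [le_div_iff₀ (by positivity)] at g2 g3 g4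
    have hYl : ∀ r ∈ Icc 0 h, ‖Y x α r - x‖ ≤ K * r := by
      intro r hr
      have := H.Y_lip hα x (τ := 1) (K := K) (s := 0) (t := r) (by
        rw [hKdef]
        have : C0 + L * ((‖x‖ + C0 * 1) * Real.exp (L * 1)) ≤
          C0 + L * ((R + C0 * 1) * Real.exp (L * 1)) := by gcongr
        linarith) le_rfl hr.1 (hr.2.trans g1)
      rwa [H.Y_zero hα, sub_zero] at this
    set d := x - s x with hd
    set D := Y x α h - x with hD
    have hDK : ‖D‖ ≤ K * h := hYl h ⟨hh.le, le_rfl⟩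
    have e1 := hmin (Y x α h) (s x) h5.le
    have e2 : Y x α h - s x = D + d := by rw [hD, hd]; abel
    rw [e2, norm_add_sq_real] at e1
    set p := (1 / ε) • d with hp
    have e3 : inner ℝ p D = inner ℝ D d / ε := by
      rw [hp, real_inner_smul_left, real_inner_comm]; ring
    have hc := H.Y_cont hα x
    have e4 : inner ℝ p D = ∫ r in (0:ℝ)..h, inner ℝ p (f (Y x α r) (α r)) := by
      have : D = ∫ r in (0:ℝ)..h, f (Y x α r) (α r) := by
        rw [hD, H.Y_eq hα x hh.le]; simp
      rw [this]
      exact ((innerSL ℝ p).intervalIntegral_comp_comm (H.int_f hα hc 0 h)).symm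
    have hd3 : L * ‖d‖ * ‖p‖ ≤ δ / 5 := by
      rw [hp, norm_smul, Real.norm_of_nonneg (by positivity)]
      have := h3.trans (min_le_right _ _)
      rw [le_div_iff₀ (by positivity)] at this
      have e : L * ‖d‖ * (1 / ε * ‖d‖) = ‖d‖ ^ 2 / ε * L := by field_simp
      rw [e]; linarith
    have hp1 : L * (K * h) * ‖p‖ ≤ δ / 5 := by
      rw [hp, norm_smul, Real.norm_of_nonneg (by positivity)]
      have e : L * (K * h) * (1 / ε * ‖d‖) = (L * K * h / ε) * ‖d‖ := by field_simp
      rw [e]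
      have : L * K * h / ε ≤ δ / 5 := by
        rw [div_le_iff₀ hε]; linarith
      calc _ ≤ (L * K * h / ε) * 1 := by gcongr
        _ ≤ _ := by linarith
    have e5 : ∀ r ∈ Icc 0 h, inner ℝ p (f (Y x α r) (α r)) ≤ σ * ℓ (Y x α r) (α r) + 4 * δ / 5 := by
      intro r hr
      have k1 : ‖Y x α r - s x‖ ≤ K * h + ‖d‖ := by
        have : Y x α r - s x = (Y x α r - x) + d := by rw [hd]; abel
        rw [this]
        refine (norm_add_le _ _).trans ?_
        have := hYl r hr
        have : K * r ≤ K * h := by gcongr; exact hr.2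
        linarith
      have k2 : inner ℝ p (f (Y x α r) (α r)) =
          inner ℝ (f (s x) (α r)) p + inner ℝ p (f (Y x α r) (α r) - f (s x) (α r)) := by
        rw [inner_sub_right, real_inner_comm p (f (s x) (α r))]; ring
      have k3 : inner ℝ p (f (Y x α r) (α r) - f (s x) (α r)) ≤ ‖p‖ * (L * (K * h + ‖d‖)) := by
        refine (real_inner_le_norm _ _).trans ?_
        gcongr
        exact (H.hfLip _ _ _ (hα.2 r)).trans (by gcongr)
      have k4 : |ℓ (Y x α r) (α r) - ℓ (s x) (α r)| ≤ δ / 5 := by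
        refine (H.hH8 _ _ _ (hα.2 r)).trans (le_trans (H.hωmono ?_) hωρ)
        have := h1.trans (min_le_right _ _)
        linarith
      have k5 : σ * (ℓ (s x) (α r) - ℓ (Y x α r) (α r)) ≤ δ / 5 := by
        refine (le_abs_self _).trans ?_
        rw [abs_mul, abs_sub_comm]
        calc _ ≤ 1 * (δ / 5) := by gcongr
          _ = _ := one_mul _
      have k6 := hle r
      have k7 : ‖p‖ * (L * (K * h + ‖d‖)) = L * (K * h) * ‖p‖ + L * ‖d‖ * ‖p‖ := by ring
      rw [mul_sub] at k5
      rw [k2]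
      linarith
    have e6 : inner ℝ p D ≤ σ * costU ℓ Y x α h + h * (4 * δ / 5) := by
      rw [e4]
      have il := H.int_l hα hc 0 h
      calc _ ≤ ∫ r in (0:ℝ)..h, (σ * ℓ (Y x α r) (α r) + 4 * δ / 5) := by
            refine intervalIntegral.integral_mono_on hh.le ?_ ?_ e5
            · exact ⟨(innerSL ℝ p).integrable_comp (H.int_f hα hc 0 h).1,
                (innerSL ℝ p).integrable_comp (H.int_f hα hc 0 h).2⟩
            · exact (il.const_mul _).add (by simp)
        _ = _ := by
            rw [intervalIntegral.integral_add (il.const_mul _) (by simp),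
              intervalIntegral.integral_const_mul, intervalIntegral.integral_const]
            simp [costU]
    have e7 : ‖D‖ ^ 2 / (2 * ε) ≤ h * (δ / 5) := by
      rw [div_le_iff₀ (by positivity)]
      have q1 : ‖D‖ ^ 2 ≤ (K * h) ^ 2 := by gcongr
      have q2 : h * (h * (5 * K ^ 2)) ≤ h * (δ * ε) := by gcongr
      have q3 : 0 ≤ h * (δ * ε) := by positivity
      have q4 : (K * h) ^ 2 = h * (h * (5 * K ^ 2)) / 5 := by ring
      have q5 : h * (δ / 5) * (2 * ε) = 2 * (h * (δ * ε)) / 5 := by ring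
      linarith
    have e8 : (‖D‖ ^ 2 + 2 * inner ℝ D d + ‖d‖ ^ 2) / (2 * ε) =
        ‖D‖ ^ 2 / (2 * ε) + inner ℝ p D + ‖d‖ ^ 2 / (2 * ε) := by
      rw [e3]; field_simp
    rw [e8] at e1
    simp only
    rw [← hd]
    linarith

end HypU

/-- `x` can be steered to the target with cost at most `c`. -/
def ReachU {N M : ℕ} (A : Set (EuclideanSpace ℝ (Fin M)))
    (T : Set (EuclideanSpace ℝ (Fin N)))
    (ℓ : EuclideanSpace ℝ (Fin N) → EuclideanSpace ℝ (Fin M) → ℝ)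
    (Y : EuclideanSpace ℝ (Fin N) → (ℝ → EuclideanSpace ℝ (Fin M)) → ℝ →
      EuclideanSpace ℝ (Fin N))
    (x : EuclideanSpace ℝ (Fin N)) (c : ℝ) : Prop :=
  ∃ α, IsControl A α ∧ ∃ t, 0 ≤ t ∧ Y x α t ∈ T ∧ costU ℓ Y x α t ≤ c

lemma gradient_sqU {N : ℕ} (c : ℝ) (x s : EuclideanSpace ℝ (Fin N)) :
    gradient (fun y => c * ‖x - y‖ ^ 2) s = (2 * c) • (s - x) := by
  apply HasGradientAt.gradient
  rw [hasGradientAt_iff_hasFDerivAt]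
  have h1 : HasFDerivAt (fun y : EuclideanSpace ℝ (Fin N) => x - y)
      (-(ContinuousLinearMap.id ℝ (EuclideanSpace ℝ (Fin N)))) s := (hasFDerivAt_id s).const_sub x
  have h2 := (h1.norm_sq).const_mul c
  refine h2.congr_fderiv ?_
  ext v
  simp [inner_smul_left, inner_sub_left]
  ring

lemma sep_radU {N : ℕ} {K T : Set (EuclideanSpace ℝ (Fin N))} (hK : IsCompact K) (hT : IsClosed T)
    (h : ∀ x ∈ K, x ∉ T) : ∃ rb : ℝ, 0 < rb ∧ ∀ x ∈ K, ∀ z, ‖x - z‖ ≤ rb → z ∉ T := by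
  obtain ⟨rb, hrb, hs⟩ := hK.exists_cthickening_subset_open hT.isOpen_compl h
  refine ⟨rb, hrb, fun x hx z hz => hs (mem_cthickening_of_dist_le z x rb K hx ?_)⟩
  rwa [dist_comm, dist_eq_norm]

namespace HypU

variable {N M : ℕ} {A : Set (EuclideanSpace ℝ (Fin M))}
    {f : EuclideanSpace ℝ (Fin N) → EuclideanSpace ℝ (Fin M) → EuclideanSpace ℝ (Fin N)}
    {ℓ : EuclideanSpace ℝ (Fin N) → EuclideanSpace ℝ (Fin M) → ℝ}
    {Y : EuclideanSpace ℝ (Fin N) → (ℝ → EuclideanSpace ℝ (Fin M)) → ℝ →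
      EuclideanSpace ℝ (Fin N)} {L C0 C1 : ℝ} {ω : ℝ → ℝ}
    {T : Set (EuclideanSpace ℝ (Fin N))} {w : EuclideanSpace ℝ (Fin N) → ℝ}

lemma const_ctl {a : EuclideanSpace ℝ (Fin M)} (ha : a ∈ A) : IsControl A (fun _ => a) :=
  ⟨measurable_const, fun _ => ha⟩

lemma reach_cat (H : HypU A f ℓ Y L C0 C1 ω) {α} (hα : IsControl A α) {x} {τ c : ℝ} (hτ : 0 ≤ τ)
    (h : ReachU A T ℓ Y (Y x α τ) c) : ReachU A T ℓ Y x (costU ℓ Y x α τ + c) := by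
  obtain ⟨β, hβ, t, ht, h1, h2⟩ := h
  refine ⟨catU α τ β, cat_ctl hα hβ τ, τ + t, add_nonneg hτ ht, ?_, ?_⟩
  · rwa [H.Y_cat_right hα hβ x hτ ht]
  · rw [H.cost_cat_right hα hβ x hτ ht]; linarith

lemma reach_mono {x} {c d : ℝ} (hcd : c ≤ d) (h : ReachU A T ℓ Y x c) : ReachU A T ℓ Y x d := by
  obtain ⟨β, hβ, t, ht, h1, h2⟩ := h
  exact ⟨β, hβ, t, ht, h1, h2.trans hcd⟩

lemma visc_super (H : HypU A f ℓ Y L C0 C1 ω)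
    (hsol : IsViscositySolU
      (fun x p => ⨆ a : A,
        (-(inner (𝕜 := ℝ) (f x (a : EuclideanSpace ℝ (Fin M))) p : ℝ) -
          ℓ x (a : EuclideanSpace ℝ (Fin M)))) Tᶜ w) {x s} (hs : s ∉ T) {ε δ : ℝ} (hε : 0 < ε)
    (hδ : 0 < δ)
    (hmin : IsLocalMin (fun y => w y + ‖x - y‖ ^ 2 / (2 * ε)) s) :
    ∃ a ∈ A, inner ℝ (f s a) ((1 / ε) • (x - s)) ≤ (-1) * ℓ s a + δ := by
  have h := hsol.1 (fun y => (-1 / (2 * ε)) * ‖x - y‖ ^ 2) ?_ s hs ?_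
  · rw [gradient_sqU] at h
    have hv : (2 * (-1 / (2 * ε))) • (s - x) = (1 / ε) • (x - s) := by
      rw [← neg_sub x s, smul_neg, ← neg_smul]; congr 1; field_simp
    rw [hv] at h
    haveI : Nonempty A := H.ne.to_subtype
    obtain ⟨a, ha⟩ := exists_lt_of_lt_ciSup (lt_of_lt_of_le (neg_lt_zero.2 hδ) h)
    exact ⟨a, a.2, by linarith⟩
  · apply ContDiff.contDiffOn
    exact contDiff_const.mul ((contDiff_const.sub contDiff_id).norm_sq ℝ)
  · apply IsLocalMin.on
    refine hmin.congr (Eventually.of_forall fun y => ?_)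
    simp only; ring

lemma visc_sub (H : HypU A f ℓ Y L C0 C1 ω)
    (hsol : IsViscositySolU
      (fun x p => ⨆ a : A,
        (-(inner (𝕜 := ℝ) (f x (a : EuclideanSpace ℝ (Fin M))) p : ℝ) -
          ℓ x (a : EuclideanSpace ℝ (Fin M)))) Tᶜ w) {x s} (hs : s ∉ T) {ε : ℝ} (hε : 0 < ε)
    (hmin : IsLocalMin (fun y => - w y + ‖x - y‖ ^ 2 / (2 * ε)) s) :
    ∀ a ∈ A, inner ℝ (f s a) ((1 / ε) • (x - s)) ≤ 1 * ℓ s a := by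
  have h := hsol.2 (fun y => (1 / (2 * ε)) * ‖x - y‖ ^ 2) ?_ s hs ?_
  · rw [gradient_sqU] at h
    have hv : (2 * (1 / (2 * ε))) • (s - x) = -((1 / ε) • (x - s)) := by
      rw [← neg_sub x s, smul_neg]; congr 2; field_simp
    rw [hv] at h
    intro a ha
    have hb : BddAbove (range fun a : A =>
        (-(inner (𝕜 := ℝ) (f s (a : EuclideanSpace ℝ (Fin M))) (-((1 / ε) • (x - s))) : ℝ) -
          ℓ s (a : EuclideanSpace ℝ (Fin M)))) := by
      refine ⟨(C0 + L * ‖s‖) * ‖(1 / ε) • (x - s)‖, ?_⟩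
      rintro _ ⟨b, rfl⟩
      have h1 := H.hℓnn s b b.2
      have h2 := real_inner_le_norm (f s b) ((1 / ε) • (x - s))
      have h3 : ‖f s b‖ * ‖(1 / ε) • (x - s)‖ ≤ (C0 + L * ‖s‖) * ‖(1 / ε) • (x - s)‖ := by
        gcongr; exact H.f_le _ b.2
      simp only [inner_neg_right, neg_neg]
      linarith
    have := (le_ciSup hb ⟨a, ha⟩).trans h
    simp only [inner_neg_right, neg_neg] at this
    linarith
  · apply ContDiff.contDiffOn
    exact contDiff_const.mul ((contDiff_const.sub contDiff_id).norm_sq ℝ)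
  · apply IsLocalMax.on
    have := hmin.neg
    refine IsLocalMax.congr this (Eventually.of_forall fun y => ?_)
    simp only; ring

lemma exists_mesh {h0 τ : ℝ} (hh : 0 < h0) (hτ : 0 < τ) : ∃ n : ℕ, 0 < n ∧ τ / n ≤ h0 := by
  obtain ⟨n, hn⟩ := exists_nat_gt (τ / h0)
  have hn0 : (0:ℝ) < n := lt_trans (by positivity) hn
  refine ⟨n, by exact_mod_cast hn0, ?_⟩
  rw [div_lt_iff₀ hh] at hn
  rw [div_le_iff₀ hn0]; linarith

/-- Suboptimality principle. -/
lemma subopt (H : HypU A f ℓ Y L C0 C1 ω) (hT : IsClosed T) (hw : Continuous w)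
    (hsol : IsViscositySolU
      (fun x p => ⨆ a : A,
        (-(inner (𝕜 := ℝ) (f x (a : EuclideanSpace ℝ (Fin M))) p : ℝ) -
          ℓ x (a : EuclideanSpace ℝ (Fin M)))) Tᶜ w) {x α} (hα : IsControl A α) {τ : ℝ}
    (hτ : 0 < τ) (hnT : ∀ t ∈ Icc 0 τ, Y x α t ∉ T) :
    w x ≤ w (Y x α τ) + costU ℓ Y x α τ := by
  have hc := H.Y_cont hα x
  have key : ∀ δ > 0, w x ≤ w (Y x α τ) + costU ℓ Y x α τ + (τ + 1) * δ := by
    intro δ hδ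
    obtain ⟨rb, hrb, hsep⟩ := sep_radU ((isCompact_Icc (a := 0) (b := τ)).image hc) hT (by
      rintro _ ⟨t, ht, rfl⟩; exact hnT t ht)
    have hL := H.hL
    have hC0 := H.C0_nn
    obtain ⟨ε, hε, s, W, h0, hh0, hW, hst⟩ := H.step (u := fun y => - w y) hw.neg (σ := 1) (by simp)
      (R := (‖x‖ + C0 * τ) * Real.exp (L * τ)) (by positivity) hrb hδ
    obtain ⟨n, hn, hnh⟩ := exists_mesh hh0 hτ
    have hn' : (0:ℝ) < n := by exact_mod_cast hn
    set h := τ / n with hhdef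
    have hh : 0 < h := by positivity
    have hnh' : n * h = τ := by rw [hhdef]; field_simp
    have ind : ∀ k : ℕ, k ≤ n → W (Y x α (k * h)) ≤ W x + costU ℓ Y x α (k * h) + k * h * δ := by
      intro k
      induction k with
      | zero => intro _; simp [H.Y_zero hα, costU]
      | succ k ih =>
        intro hk
        have ih := ih (by omega)
        have hk0 : 0 ≤ (k:ℝ) * h := by positivity
        have hkτ : (k:ℝ) * h ≤ τ := by
          rw [← hnh']; gcongr; omega
        have hkI : (k:ℝ) * h ∈ Icc 0 τ := ⟨hk0, hkτ⟩
        have hb := H.Y_bound hα x (τ := τ) _ hkI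
        obtain ⟨w1, w2, w3, w4⟩ := hW _ hb
        have hsT := hsep _ (mem_image_of_mem _ hkI) _ w3
        have hv := H.visc_sub hsol hsT hε w4
        have := hst _ hb _ (shift_ctl hα (k * h)) h hh hnh (fun r => by
          have := hv _ (hα.2 (k * h + r)); linarith)
        rw [H.Y_shift hα x hk0 hh.le] at this
        have hcs := H.cost_shift hα x hk0 hh.le
        have e : ((k + 1 : ℕ) : ℝ) * h = k * h + h := by push_cast; ring
        rw [e, hcs]
        linarith
    have hfin := ind n le_rfl
    rw [hnh'] at hfin
    obtain ⟨w1, -⟩ := hW x (by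
      have := H.Y_bound hα x (τ := τ) 0 ⟨le_rfl, hτ.le⟩
      rwa [H.Y_zero hα] at this)
    obtain ⟨-, w2, -⟩ := hW _ (H.Y_bound hα x (τ := τ) τ ⟨hτ.le, le_rfl⟩)
    linarith
  refine le_of_forall_pos_le_add fun e he => ?_
  have := key (e / (τ + 1)) (by positivity)
  rwa [mul_div_cancel₀ _ (by positivity)] at this

/-- Superoptimality over unit time. -/
lemma super_one (H : HypU A f ℓ Y L C0 C1 ω) (hT : IsClosed T) (hw : Continuous w)
    (hsol : IsViscositySolU
      (fun x p => ⨆ a : A,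
        (-(inner (𝕜 := ℝ) (f x (a : EuclideanSpace ℝ (Fin M))) p : ℝ) -
          ℓ x (a : EuclideanSpace ℝ (Fin M)))) Tᶜ w)
    {O : Set (EuclideanSpace ℝ (Fin N))} (hO : IsOpen O) (hTO : T ⊆ O) {η : ℝ}
    (hOr : ∀ z ∈ O, ReachU A T ℓ Y z (w z + η)) {x} {δ : ℝ} (hδ : 0 < δ)
    (hx : ¬ ReachU A T ℓ Y x (w x + η + δ)) :
    ∃ α, IsControl A α ∧ w (Y x α 1) + costU ℓ Y x α 1 ≤ w x + δ := by
  have hL := H.hL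
  have hC0 := H.C0_nn
  set R := (‖x‖ + C0 * 1) * Real.exp (L * 1) with hR
  have hR0 : 0 ≤ R := by positivity
  obtain ⟨rb, hrb, hsep⟩ := sep_radU ((isCompact_closedBall (0 : EuclideanSpace ℝ (Fin N)) R).diff hO)
    hT (fun y hy hyT => hy.2 (hTO hyT))
  obtain ⟨ε, hε, s, W, h0, hh0, hW, hst⟩ := H.step hw (σ := -1) (by simp) hR0 hrb (half_pos hδ)
  obtain ⟨n, hn, hnh⟩ := exists_mesh hh0 one_pos
  have hn' : (0:ℝ) < n := by exact_mod_cast hn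
  set h := (1:ℝ) / n with hhdef
  have hh : 0 < h := by positivity
  have hnh' : n * h = 1 := by rw [hhdef]; field_simp
  have hxb : ‖x‖ ≤ R := by
    obtain ⟨a, ha⟩ := H.ne
    have := H.Y_bound (const_ctl ha) x (τ := 1) 0 ⟨le_rfl, zero_le_one⟩
    rwa [H.Y_zero (const_ctl ha)] at this
  obtain ⟨wx, -⟩ := hW x hxb
  have ind : ∀ k : ℕ, k ≤ n → ∃ α, IsControl A α ∧
      W (Y x α (k * h)) ≤ W x - costU ℓ Y x α (k * h) + k * h * (δ / 2) := by
    intro k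
    induction k with
    | zero =>
      intro _
      obtain ⟨a, ha⟩ := H.ne
      exact ⟨_, const_ctl ha, by simp [H.Y_zero (const_ctl ha), costU]⟩
    | succ k ih =>
      intro hk
      obtain ⟨α, hα, ih⟩ := ih (by omega)
      have hk0 : 0 ≤ (k:ℝ) * h := by positivity
      have hk1 : (k:ℝ) * h ≤ 1 := by
        rw [← hnh']; gcongr; omega
      have hb := H.Y_bound hα x (τ := 1) _ ⟨hk0, hk1⟩
      obtain ⟨w1, w2, w3, w4⟩ := hW _ hb
      have hzO : Y x α (k * h) ∉ O := by
        intro hz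
        refine hx (reach_mono ?_ (H.reach_cat hα hk0 (hOr _ hz)))
        have : k * h * (δ / 2) ≤ 1 * (δ / 2) := by gcongr
        linarith
      have hsT := hsep _ ⟨mem_closedBall_zero_iff.2 hb, hzO⟩ _ w3
      obtain ⟨a, ha, hv⟩ := H.visc_super hsol hsT hε (δ := δ / 2 / 5) (by positivity) w4
      have := hst _ hb _ (const_ctl ha) h hh hnh (fun r => hv)
      refine ⟨catU α (k * h) (fun _ => a), cat_ctl hα (const_ctl ha) _, ?_⟩
      have e : ((k + 1 : ℕ) : ℝ) * h = k * h + h := by push_cast; ring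
      rw [e, H.Y_cat_right hα (const_ctl ha) x hk0 hh.le,
        H.cost_cat_right hα (const_ctl ha) x hk0 hh.le]
      linarith
  obtain ⟨α, hα, hfin⟩ := ind n le_rfl
  rw [hnh'] at hfin
  obtain ⟨-, w2, -⟩ := hW _ (H.Y_bound hα x (τ := 1) 1 ⟨zero_le_one, le_rfl⟩)
  exact ⟨α, hα, by linarith⟩

end HypU

/-- Nonnegative Caratheodory functions on `ℝ × A`. -/
structure CarU {M : ℕ} (A : Set (EuclideanSpace ℝ (Fin M)))
    (Φ : ℝ → EuclideanSpace ℝ (Fin M) → ℝ) : Prop where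
  meas : ∀ a ∈ A, Measurable fun t => Φ t a
  cont : ∀ t, ContinuousOn (Φ t) A
  nn : ∀ t a, 0 ≤ Φ t a

section
variable {M : ℕ} {A : Set (EuclideanSpace ℝ (Fin M))}
  {Φ : ℝ → EuclideanSpace ℝ (Fin M) → ℝ}

lemma CarU.measE_compact (h : CarU A Φ) {C : Set (EuclideanSpace ℝ (Fin M))} (hC : IsCompact C)
    (hCA : C ⊆ A) : MeasurableSet {t | ∃ a ∈ C, Φ t a = 0} := by
  rcases C.eq_empty_or_nonempty with rfl | hne
  · simp
  have : Nonempty C := hne.to_subtype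
  have e : {t | ∃ a ∈ C, Φ t a = 0} =
      ⋂ n : ℕ, ⋃ k : ℕ, {t | Φ t (TopologicalSpace.denseSeq C k : C) < 1 / ((n:ℝ) + 1)} := by
    ext t
    simp only [mem_setOf_eq, mem_iInter, mem_iUnion]
    have hc : ContinuousOn (Φ t) C := (h.cont t).mono hCA
    constructor
    · rintro ⟨a, ha, h0⟩ n
      have hop : IsOpen {c : C | Φ t c < 1 / ((n:ℝ) + 1)} :=
        isOpen_lt (continuousOn_iff_continuous_restrict.1 hc) continuous_const
      obtain ⟨x, hx, k, rfl⟩ := (TopologicalSpace.denseRange_denseSeq C).exists_mem_open hop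
        ⟨⟨a, ha⟩, by simp only [mem_setOf_eq, h0]; positivity⟩ |> fun ⟨k, hk⟩ => 
          (⟨_, hk, k, rfl⟩ : ∃ x, x ∈ {c : C | Φ t c < 1 / ((n:ℝ) + 1)} ∧
            ∃ k, TopologicalSpace.denseSeq C k = x)
      exact ⟨k, hx⟩
    · intro hn
      obtain ⟨a, ha, hmin⟩ := hC.exists_isMinOn hne hc
      refine ⟨a, ha, ?_⟩
      by_contra h0
      have hpos : 0 < Φ t a := lt_of_le_of_ne (h.nn t a) (Ne.symm h0)
      obtain ⟨n, hn'⟩ := exists_nat_one_div_lt hpos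
      obtain ⟨k, hk⟩ := hn n
      have := hmin (TopologicalSpace.denseSeq C k).2
      simp only [mem_setOf_eq] at this
      linarith
  rw [e]
  refine MeasurableSet.iInter fun n => MeasurableSet.iUnion fun k => ?_
  exact measurableSet_lt (h.meas _ (hCA (TopologicalSpace.denseSeq C k).2)) measurable_const

lemma CarU.measE (h : CarU A Φ) {C : Set (EuclideanSpace ℝ (Fin M))} (hC : IsClosed C)
    (hCA : C ⊆ A) : MeasurableSet {t | ∃ a ∈ C, Φ t a = 0} := by
  have e : {t | ∃ a ∈ C, Φ t a = 0} =
      ⋃ n : ℕ, {t | ∃ a ∈ C ∩ closedBall 0 n, Φ t a = 0} := by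
    ext t
    simp only [mem_setOf_eq, mem_iUnion, mem_inter_iff, mem_closedBall_zero_iff]
    constructor
    · rintro ⟨a, ha, h0⟩
      obtain ⟨n, hn⟩ := exists_nat_ge ‖a‖
      exact ⟨n, a, ⟨ha, hn⟩, h0⟩
    · rintro ⟨n, a, ⟨ha, hn⟩, h0⟩
      exact ⟨a, ha, h0⟩
  rw [e]
  exact MeasurableSet.iUnion fun n => h.measE_compact
    ((isCompact_closedBall _ _).inter_left hC) (inter_subset_left.trans hCA)

lemma CarU.step (h : CarU A Φ) (hA : IsClosed A) {g : EuclideanSpace ℝ (Fin M) → ℝ}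
    (hg : Continuous g) (hb : ∀ t c, ∃ R : ℝ, ∀ a ∈ A, Φ t a = 0 → g a ≤ c → ‖a‖ ≤ R) :
    ∃ γ : ℝ → ℝ, Measurable γ ∧ ∀ t, (∃ a ∈ A, Φ t a = 0) →
      ∃ a ∈ A, Φ t a = 0 ∧ g a = γ t := by
  have key : ∀ t, (∃ a ∈ A, Φ t a = 0) →
      ∃ a ∈ A, Φ t a = 0 ∧ ∀ b ∈ A, Φ t b = 0 → g a ≤ g b := by
    rintro t ⟨a0, ha0, h0⟩
    obtain ⟨R, hR⟩ := hb t (g a0)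
    have hcl : IsClosed {a | a ∈ A ∧ Φ t a ∈ ({0} : Set ℝ)} :=
      (h.cont t).preimage_isClosed_of_isClosed hA isClosed_singleton
    have hcl2 : IsClosed {a | g a ≤ g a0} := isClosed_le hg continuous_const
    have hco : IsCompact (({a | a ∈ A ∧ Φ t a ∈ ({0} : Set ℝ)} ∩ {a | g a ≤ g a0}) ∩
        closedBall 0 R) := (isCompact_closedBall _ _).inter_left (hcl.inter hcl2)
    obtain ⟨a, ⟨⟨⟨ha, ha'⟩, hag⟩, -⟩, hmin⟩ := hco.exists_isMinOn
      ⟨a0, ⟨⟨ha0, h0⟩, le_refl (g a0)⟩, mem_closedBall_zero_iff.2 (hR a0 ha0 h0 le_rfl)⟩ hg.continuousOn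
    refine ⟨a, ha, ha', fun b hbA hb0 => ?_⟩
    by_cases hbg : g b ≤ g a0
    · exact hmin ⟨⟨⟨hbA, hb0⟩, hbg⟩, mem_closedBall_zero_iff.2 (hR b hbA hb0 hbg)⟩
    · exact le_trans hag (le_of_not_ge hbg)
  classical
  let E := {t | ∃ a ∈ A, Φ t a = 0}
  have hE : MeasurableSet E := h.measE hA subset_rfl
  refine ⟨fun t => if ht : t ∈ E then g (key t ht).choose else 0, ?_, ?_⟩
  · refine measurable_of_Iic fun c => ?_
    have e : (fun t => if ht : t ∈ E then g (key t ht).choose else 0) ⁻¹' (Iic c) =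
        {t | ∃ a ∈ A ∩ {a | g a ≤ c}, Φ t a = 0} ∪ (Eᶜ ∩ {_t : ℝ | 0 ≤ c}) := by
      ext t
      by_cases ht : t ∈ E
      · have hs := (key t ht).choose_spec
        simp only [mem_preimage, ht, dif_pos, mem_Iic, mem_union, mem_setOf_eq, mem_inter_iff,
          mem_compl_iff, not_true, false_and, or_false]
        constructor
        · intro hle
          exact ⟨_, ⟨hs.1, hle⟩, hs.2.1⟩
        · rintro ⟨b, ⟨hbA, hbc⟩, hb0⟩
          exact (hs.2.2 b hbA hb0).trans hbc
      · have : ¬ ∃ a ∈ A ∩ {a | g a ≤ c}, Φ t a = 0 := by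
          rintro ⟨b, ⟨hbA, -⟩, hb0⟩
          exact ht ⟨b, hbA, hb0⟩
        have hz : (if ht : t ∈ E then g (key t ht).choose else 0) = 0 := dif_neg ht
        constructor
        · intro hle
          exact Or.inr ⟨ht, hz ▸ (show (if ht : t ∈ E then g (key t ht).choose else 0) ≤ c from hle)⟩
        · rintro (h1 | h1)
          · exact absurd h1 this
          · show (if ht : t ∈ E then g (key t ht).choose else 0) ≤ c
            rw [hz]; exact h1.2
    rw [e]
    exact (h.measE (hA.inter (isClosed_le hg continuous_const)) inter_subset_left).union
      (hE.compl.inter (MeasurableSet.const _))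
  · intro t ht
    refine ⟨(key t ht).choose, (key t ht).choose_spec.1, (key t ht).choose_spec.2.1, ?_⟩
    have : t ∈ E := ht
    simp [this]

lemma CarU.add (h : CarU A Φ) {g : EuclideanSpace ℝ (Fin M) → ℝ}
    (hg : Continuous g) {γ : ℝ → ℝ} (hγ : Measurable γ) :
    CarU A (fun t a => Φ t a + |g a - γ t|) where
  meas a ha := (h.meas a ha).add ((measurable_const.sub hγ).abs)
  cont t := (h.cont t).add (by fun_prop)
  nn t a := add_nonneg (h.nn t a) (abs_nonneg _)

lemma CarU.coords (h : CarU A Φ) (hA : IsClosed A)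
    (hb : ∀ t, ∃ R : ℝ, ∀ a ∈ A, Φ t a = 0 → ‖a‖ ≤ R) (s : Finset (Fin M)) :
    ∃ Ψ, CarU A Ψ ∧ (∀ t a, Ψ t a = 0 → Φ t a = 0) ∧
      (∀ t, (∃ a ∈ A, Φ t a = 0) → ∃ a ∈ A, Ψ t a = 0) ∧
      ∀ i ∈ s, ∃ γ : ℝ → ℝ, Measurable γ ∧ ∀ t a, Ψ t a = 0 → a i = γ t := by
  classical
  induction s using Finset.induction_on with
  | empty => exact ⟨Φ, h, fun _ _ h => h, fun _ h => h, by simp⟩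
  | insert j s hj ih =>
    obtain ⟨Ψ, h1, h2, h3, h4⟩ := ih
    have hg : Continuous fun a : EuclideanSpace ℝ (Fin M) => a j := by fun_prop
    obtain ⟨γ, hγ, hγ'⟩ := h1.step hA hg (fun t c => by
      obtain ⟨R, hR⟩ := hb t
      exact ⟨R, fun a ha h0 _ => hR a ha (h2 _ _ h0)⟩)
    have sp : ∀ t a, Ψ t a + |a j - γ t| = 0 → Ψ t a = 0 ∧ a j = γ t := by
      intro t a h0
      have := h1.nn t a
      have h' := abs_nonneg (a j - γ t)
      refine ⟨by linarith, ?_⟩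
      have : |a j - γ t| = 0 := by linarith
      exact sub_eq_zero.1 (abs_eq_zero.1 this)
    refine ⟨fun t a => Ψ t a + |a j - γ t|, h1.add hg hγ, fun t a h0 => h2 _ _ (sp t a h0).1,
      ?_, ?_⟩
    · intro t ht
      obtain ⟨a, ha, h0, h0'⟩ := hγ' t (h3 t ht)
      exact ⟨a, ha, by simp only [h0, h0']; simp⟩
    · intro i hi
      rcases Finset.mem_insert.1 hi with rfl | hi
      · exact ⟨γ, hγ, fun t a h0 => (sp t a h0).2⟩
      · obtain ⟨γ', m, hh⟩ := h4 i hi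
        exact ⟨γ', m, fun t a h0 => hh t a (sp t a h0).1⟩

lemma CarU.select (h : CarU A Φ) (hA : IsClosed A) (hne : A.Nonempty) :
    ∃ β : ℝ → EuclideanSpace ℝ (Fin M), Measurable β ∧ (∀ t, β t ∈ A) ∧
      ∀ t, (∃ a ∈ A, Φ t a = 0) → Φ t (β t) = 0 := by
  classical
  obtain ⟨γ, hγ, hγ'⟩ := h.step hA continuous_norm (fun t c => ⟨c, fun a _ _ h => h⟩)
  have h0 := h.add continuous_norm hγ
  have sp : ∀ t a, Φ t a + |‖a‖ - γ t| = 0 → Φ t a = 0 ∧ ‖a‖ = γ t := by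
    intro t a h0
    have := h.nn t a
    have h' := abs_nonneg (‖a‖ - γ t)
    refine ⟨by linarith, ?_⟩
    have : |‖a‖ - γ t| = 0 := by linarith
    exact sub_eq_zero.1 (abs_eq_zero.1 this)
  obtain ⟨Ψ, h1, h2, h3, h4⟩ := h0.coords hA
    (fun t => ⟨γ t, fun a _ h0 => (sp t a h0).2.le⟩) Finset.univ
  choose! η hη hη' using h4
  obtain ⟨a0, ha0⟩ := hne
  let E := {t | ∃ a ∈ A, Φ t a = 0}
  have hE : MeasurableSet E := h.measE hA subset_rfl
  have key : ∀ t ∈ E, (WithLp.toLp 2 (fun i => η i t) : EuclideanSpace ℝ (Fin M)) ∈ A ∧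
      Φ t (WithLp.toLp 2 (fun i => η i t)) = 0 := by
    intro t ht
    obtain ⟨b, hb, hb0, hb1⟩ := hγ' t ht
    obtain ⟨a, ha, hz⟩ := h3 t ⟨b, hb, by rw [hb0, hb1]; simp⟩
    have : (WithLp.toLp 2 (fun i => η i t) : EuclideanSpace ℝ (Fin M)) = a := by
      ext i
      simp [hη' i (Finset.mem_univ i) t a hz]
    rw [this]
    exact ⟨ha, (sp t a (h2 _ _ hz)).1⟩
  refine ⟨fun t => if t ∈ E then WithLp.toLp 2 (fun i => η i t) else a0, ?_, ?_, ?_⟩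
  · refine Measurable.ite hE ?_ measurable_const
    exact (WithLp.measurable_toLp 2 (Fin M → ℝ)).comp
      (measurable_pi_lambda _ fun i => hη i (Finset.mem_univ i))
  · intro t
    by_cases ht : t ∈ E
    · simp only [ht, if_true]; exact (key t ht).1
    · simp only [ht, if_false]; exact ha0
  · intro t ht
    have : t ∈ E := ht
    simp only [this, if_true]; exact (key t ht).2
end

namespace HypU

variable {N M : ℕ} {A : Set (EuclideanSpace ℝ (Fin M))}
    {f : EuclideanSpace ℝ (Fin N) → EuclideanSpace ℝ (Fin M) → EuclideanSpace ℝ (Fin N)}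
    {ℓ : EuclideanSpace ℝ (Fin N) → EuclideanSpace ℝ (Fin M) → ℝ}
    {Y : EuclideanSpace ℝ (Fin N) → (ℝ → EuclideanSpace ℝ (Fin M)) → ℝ →
      EuclideanSpace ℝ (Fin N)} {L C0 C1 : ℝ} {ω : ℝ → ℝ}
    {T : Set (EuclideanSpace ℝ (Fin N))}

lemma pair_dist (H : HypU A f ℓ Y L C0 C1 ω) (x y) {a} (ha : a ∈ A) :
    dist ((f x a, ℓ x a) : EuclideanSpace ℝ (Fin N) × ℝ) (f y a, ℓ y a) ≤
      max (L * ‖x - y‖) (ω ‖x - y‖) := by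
  rw [Prod.dist_eq, dist_eq_norm, Real.dist_eq]
  exact max_le_max (H.hfLip x y a ha) (H.hH8 x y a ha)

lemma mod_cont (H : HypU A f ℓ Y L C0 C1 ω) : Continuous fun r => max (L * r) (ω r) :=
  (continuous_const.mul continuous_id).max H.hωc

lemma mod_small (H : HypU A f ℓ Y L C0 C1 ω) {ε : ℝ} (hε : 0 < ε) :
    ∃ r > 0, ∀ s, 0 ≤ s → s ≤ r → max (L * s) (ω s) < ε := by
  have h1 : Tendsto (fun r => max (L * r) (ω r)) (𝓝 0) (𝓝 0) := by
    have := H.mod_cont.tendsto 0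
    simpa [H.hω0] using this
  have h2 := (h1.eventually_lt_const hε)
  obtain ⟨r, hr, h3⟩ := Metric.eventually_nhds_iff.1 h2
  refine ⟨r / 2, by positivity, fun s hs hsr => h3 ?_⟩
  rw [Real.dist_eq, sub_zero, abs_of_nonneg hs]; linarith

lemma D_closed (H : HypU A f ℓ Y L C0 C1 ω)
    (Fb : A → C(EuclideanSpace ℝ (Fin N), EuclideanSpace ℝ (Fin N) × ℝ))
    (hFb : ∀ (a : A) (x : EuclideanSpace ℝ (Fin N)),
      Fb a x = (f x (a : EuclideanSpace ℝ (Fin M)), ℓ x (a : EuclideanSpace ℝ (Fin M))))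
    (hNC2 : IsClosed (range Fb)) (z : EuclideanSpace ℝ (Fin N)) :
    IsClosed {q : EuclideanSpace ℝ (Fin N) × ℝ | ∃ a ∈ A, q = (f z a, ℓ z a)} := by
  refine isClosed_of_closure_subset fun q hq => ?_
  have hD : {q : EuclideanSpace ℝ (Fin N) × ℝ | ∃ a ∈ A, q = (f z a, ℓ z a)} =
      range (fun a : A => Fb a z) := by
    ext q
    simp only [mem_setOf_eq, mem_range, hFb]
    constructor
    · rintro ⟨a, ha, rfl⟩; exact ⟨⟨a, ha⟩, rfl⟩
    · rintro ⟨⟨a, ha⟩, rfl⟩; exact ⟨a, ha, rfl⟩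
  rw [hD] at hq ⊢
  have hne : (comap (fun a : A => Fb a z) (𝓝 q)).NeBot := by
    rw [comap_neBot_iff]
    intro s hs
    obtain ⟨y, hy, a, rfl⟩ := mem_closure_iff_nhds.1 hq s hs
    exact ⟨a, hy⟩
  let U : Ultrafilter A := Ultrafilter.of (comap (fun a : A => Fb a z) (𝓝 q))
  have hU : Tendsto (fun a : A => Fb a z) U (𝓝 q) :=
    (tendsto_comap).mono_left (Ultrafilter.of_le _)
  have hlim : ∀ x, ∃ g, Tendsto (fun a : A => Fb a x) U (𝓝 g) := by
    intro x
    have hc : IsCompact (closedBall (0 : EuclideanSpace ℝ (Fin N)) (C0 + L * ‖x‖) ×ˢ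
        Icc (0:ℝ) (C1 + ω ‖x‖)) := (isCompact_closedBall _ _).prod isCompact_Icc
    obtain ⟨g, -, hg⟩ := hc.ultrafilter_le_nhds' (U.map (fun a : A => Fb a x)) (by
      rw [Ultrafilter.mem_map]
      refine Filter.mem_of_superset (f := (U : Filter A)) univ_mem fun a _ => ?_
      simp only [mem_preimage, hFb]
      exact ⟨mem_closedBall_zero_iff.2 (H.f_le x a.2), H.hℓnn x a a.2, H.l_le x a.2⟩)
    exact ⟨g, hg⟩
  choose G hG using hlim
  have hGd : ∀ x y, dist (G x) (G y) ≤ max (L * ‖x - y‖) (ω ‖x - y‖) := by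
    intro x y
    refine le_of_tendsto ((hG x).dist (hG y)) (Eventually.of_forall fun a => ?_)
    rw [hFb, hFb]
    exact H.pair_dist x y a.2
  have hGc : Continuous G := by
    rw [Metric.continuous_iff]
    intro b ε hε
    obtain ⟨r, hr, h⟩ := H.mod_small hε
    refine ⟨r, hr, fun a ha => (hGd a b).trans_lt (h _ (norm_nonneg _) ?_)⟩
    rw [← dist_eq_norm]; exact ha.le
  have hT : Tendsto Fb U (𝓝 (⟨G, hGc⟩ : C(_, _))) := by
    rw [ContinuousMap.tendsto_iff_tendstoLocallyUniformly, Metric.tendstoLocallyUniformly_iff]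
    intro ε hε x
    obtain ⟨r, hr, h⟩ := H.mod_small (ε := ε / 3) (by positivity)
    refine ⟨ball x r, ball_mem_nhds x hr, ?_⟩
    filter_upwards [Metric.tendsto_nhds.1 (hG x) (ε / 3) (by positivity)] with a ha y hy
    have hyx : ‖y - x‖ ≤ r := by rw [← dist_eq_norm]; exact (mem_ball.1 hy).le
    have h1 := (hGd y x).trans_lt (h _ (norm_nonneg _) hyx)
    have h2 : dist (Fb a y) (Fb a x) < ε / 3 := by
      rw [hFb, hFb]
      exact (H.pair_dist y x a.2).trans_lt (h _ (norm_nonneg _) hyx)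
    show dist (G y) (Fb a y) < ε
    have t1 := dist_triangle4 (G y) (G x) (Fb a x) (Fb a y)
    rw [dist_comm (G x), dist_comm (Fb a x) (Fb a y)] at t1
    linarith
  obtain ⟨a, ha⟩ := hNC2.mem_of_tendsto hT (Eventually.of_forall fun a => mem_range_self a)
  refine ⟨a, ?_⟩
  have : Fb a z = G z := by rw [ha]; rfl
  show Fb a z = q
  rw [this]
  exact tendsto_nhds_unique (hG z) hU

lemma incl (H : HypU A f ℓ Y L C0 C1 ω) {z : ℝ → EuclideanSpace ℝ (Fin N)} {t : ℝ}
    (ht : t ∈ Ioo (0:ℝ) 1)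
    (hcl : IsClosed {q : EuclideanSpace ℝ (Fin N) × ℝ | ∃ a ∈ A, q = (f (z t) a, ℓ (z t) a)})
    (hconv : Convex ℝ {q : EuclideanSpace ℝ (Fin N) × ℝ | ∃ a ∈ A, q = (f (z t) a, ℓ (z t) a)})
    {U : Filter ℕ} [U.NeBot] {x : ℕ → EuclideanSpace ℝ (Fin N)}
    {α : ℕ → ℝ → EuclideanSpace ℝ (Fin M)} (hα : ∀ n, IsControl A (α n)) {K : ℝ} (hK : 0 < K)
    (hlip : ∀ n s r, 0 ≤ s → s ≤ r → r ≤ 1 → ‖Y (x n) (α n) r - Y (x n) (α n) s‖ ≤ K * (r - s))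
    (hz : ∀ s ∈ Icc (0:ℝ) 1, Tendsto (fun n => Y (x n) (α n) s) U (𝓝 (z s)))
    (hc : ∀ s ∈ Icc (0:ℝ) 1, Tendsto (fun n => costU ℓ Y (x n) (α n) s) U (𝓝 0))
    {v : EuclideanSpace ℝ (Fin N)} (hv : HasDerivAt z v t) :
    ∃ a ∈ A, ((v, 0) : EuclideanSpace ℝ (Fin N) × ℝ) = (f (z t) a, ℓ (z t) a) := by
  by_contra hno
  obtain ⟨φ, u, hφ, hu⟩ := geometric_hahn_banach_closed_point hconv hcl
    (x := ((v, 0) : EuclideanSpace ℝ (Fin N) × ℝ)) hno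
  obtain ⟨δ, hδ, hδu⟩ : ∃ δ > 0, u + δ < φ (v, 0) :=
    ⟨(φ (v, 0) - u) / 2, by linarith, by linarith⟩
  obtain ⟨r, hr, hm⟩ := H.mod_small (ε := δ / (‖φ‖ + 1)) (by positivity)
  have hder : HasDerivAt (fun s => φ (z s, 0)) (φ (v, 0)) t := by
    have h1 : HasDerivAt (fun s => (z s, (0:ℝ))) (v, 0) t := hv.prodMk (hasDerivAt_const t 0)
    exact φ.hasFDerivAt.comp_hasDerivAt t h1
  have hsl : Tendsto (slope (fun s => φ (z s, 0)) t) (𝓝[>] t) (𝓝 (φ (v, 0))) :=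
    (hasDerivAt_iff_tendsto_slope.1 hder).mono_left (nhdsWithin_mono _ fun s hs => ne_of_gt hs)
  have key : ∀ᶠ s in 𝓝[>] t, slope (fun s => φ (z s, 0)) t s ≤ u + δ := by
    have e1 : ∀ᶠ s in 𝓝[>] t, s < min 1 (t + r / (2 * K)) :=
      nhdsWithin_le_nhds (eventually_lt_nhds (lt_min ht.2 (by
        have : 0 < r / (2 * K) := by positivity
        linarith)))
    filter_upwards [e1, self_mem_nhdsWithin] with s hs hts
    have hts : t < s := hts
    have hs1 : s < 1 := hs.trans_le (min_le_left _ _)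
    have hs2 : K * (s - t) ≤ r / 2 := by
      have : s - t ≤ r / (2 * K) := by
        have := hs.trans_le (min_le_right _ _); linarith
      calc K * (s - t) ≤ K * (r / (2 * K)) := by gcongr
        _ = r / 2 := by field_simp
    have tm : t ∈ Icc (0:ℝ) 1 := ⟨ht.1.le, ht.2.le⟩
    have sm : s ∈ Icc (0:ℝ) 1 := ⟨ht.1.le.trans hts.le, hs1.le⟩
    have hn : ∀ᶠ n in U, φ (Y (x n) (α n) s - Y (x n) (α n) t,
        costU ℓ Y (x n) (α n) s - costU ℓ Y (x n) (α n) t) ≤ (u + δ) * (s - t) := by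
      filter_upwards [Metric.tendsto_nhds.1 (hz t tm) (r / 2) (by positivity)] with n hn
      have hy := H.Y_cont (hα n) (x n)
      have hif := fun a b => H.int_f (hα n) hy a b
      have hil := fun a b => H.int_l (hα n) hy a b
      let φ1 := φ.comp (ContinuousLinearMap.inl ℝ (EuclideanSpace ℝ (Fin N)) ℝ)
      let φ2 := φ.comp (ContinuousLinearMap.inr ℝ (EuclideanSpace ℝ (Fin N)) ℝ)
      have hsp : ∀ p q, φ (p, q) = φ1 p + φ2 q := by
        intro p q
        simp only [φ1, φ2, ContinuousLinearMap.comp_apply, ContinuousLinearMap.inl_apply,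
          ContinuousLinearMap.inr_apply, ← map_add]
        simp
      have hi1 : IntervalIntegrable (fun b => φ1 (f (Y (x n) (α n) b) (α n b))) volume t s :=
        ⟨φ1.integrable_comp (hif t s).1, φ1.integrable_comp (hif t s).2⟩
      have hi2 : IntervalIntegrable (fun b => φ2 (ℓ (Y (x n) (α n) b) (α n b))) volume t s :=
        ⟨φ2.integrable_comp (hil t s).1, φ2.integrable_comp (hil t s).2⟩
      have e : φ (Y (x n) (α n) s - Y (x n) (α n) t,
          costU ℓ Y (x n) (α n) s - costU ℓ Y (x n) (α n) t) =
          ∫ b in t..s, φ (f (Y (x n) (α n) b) (α n b), ℓ (Y (x n) (α n) b) (α n b)) := by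
        rw [H.Y_eq (hα n) _ sm.1, H.Y_eq (hα n) _ tm.1, add_sub_add_left_eq_sub,
          intervalIntegral.integral_interval_sub_left (hif _ _) (hif _ _)]
        unfold costU
        rw [intervalIntegral.integral_interval_sub_left (hil _ _) (hil _ _)]
        simp only [hsp]
        rw [intervalIntegral.integral_add hi1 hi2, φ1.intervalIntegral_comp_comm (hif _ _),
          φ2.intervalIntegral_comp_comm (hil _ _)]
      rw [e]
      have hle := intervalIntegral.integral_mono_on (g := fun _ => u + δ) hts.le
        (f := fun b => φ (f (Y (x n) (α n) b) (α n b), ℓ (Y (x n) (α n) b) (α n b)))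
        (by simp only [hsp]; exact hi1.add hi2) (by simp) (by
          intro b hb
          have hd : ‖Y (x n) (α n) b - z t‖ ≤ r := by
            have h1 := hlip n t b tm.1 hb.1 (hb.2.trans hs1.le)
            have h2 : K * (b - t) ≤ K * (s - t) := by gcongr; exact hb.2
            rw [dist_eq_norm] at hn
            have h3 := norm_sub_le_norm_sub_add_norm_sub (Y (x n) (α n) b) (Y (x n) (α n) t) (z t)
            linarith
          have hA := (hα n).2 b
          have h4 := hφ _ ⟨α n b, hA, rfl⟩
          have h5 := (H.pair_dist (Y (x n) (α n) b) (z t) hA).trans_lt (hm _ (norm_nonneg _) hd)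
          rw [dist_eq_norm] at h5
          have h6 := φ.le_opNorm ((f (Y (x n) (α n) b) (α n b), ℓ (Y (x n) (α n) b) (α n b)) -
            (f (z t) (α n b), ℓ (z t) (α n b)))
          have h7 : ‖φ‖ * ‖((f (Y (x n) (α n) b) (α n b), ℓ (Y (x n) (α n) b) (α n b)) :
              EuclideanSpace ℝ (Fin N) × ℝ) -
            (f (z t) (α n b), ℓ (z t) (α n b))‖ ≤ (‖φ‖ + 1) * (δ / (‖φ‖ + 1)) := by
            gcongr
            linarith
          have h8 : (‖φ‖ + 1) * (δ / (‖φ‖ + 1)) = δ := by field_simp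
          rw [map_sub, Real.norm_eq_abs] at h6
          have h9 := le_abs_self (φ (f (Y (x n) (α n) b) (α n b), ℓ (Y (x n) (α n) b) (α n b)) -
            φ (f (z t) (α n b), ℓ (z t) (α n b)))
          linarith)
      rw [intervalIntegral.integral_const, smul_eq_mul] at hle
      linarith
    have hlim : Tendsto (fun n => φ (Y (x n) (α n) s - Y (x n) (α n) t,
        costU ℓ Y (x n) (α n) s - costU ℓ Y (x n) (α n) t)) U (𝓝 (φ (z s - z t, 0 - 0))) :=
      (φ.continuous.tendsto _).comp
        (((hz s sm).sub (hz t tm)).prodMk_nhds ((hc s sm).sub (hc t tm)))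
    have hfin := le_of_tendsto hlim hn
    rw [slope_def_field, ← map_sub, Prod.mk_sub_mk, div_le_iff₀ (by linarith)]
    exact hfin
  have := le_of_tendsto hsl key
  linarith

end HypU

lemma lip_ftcU {N : ℕ} {z : ℝ → EuclideanSpace ℝ (Fin N)} {K : NNReal} (hz : LipschitzWith K z)
    {g : ℝ → EuclideanSpace ℝ (Fin N)} {t : ℝ} (hg : IntervalIntegrable g volume 0 t)
    (h : ∀ᵐ s, s ∈ uIoc 0 t → HasDerivAt z (g s) s) : z t = z 0 + ∫ s in (0:ℝ)..t, g s := by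
  ext i
  let p : EuclideanSpace ℝ (Fin N) →L[ℝ] ℝ := EuclideanSpace.proj i
  have e1 : ∫ s in (0:ℝ)..t, p (g s) = p (∫ s in (0:ℝ)..t, g s) :=
    p.intervalIntegral_comp_comm hg
  have hl : LipschitzWith (‖p‖₊ * K) (fun s => p (z s)) := p.lipschitz.comp hz
  have e2 := ((hl.lipschitzOnWith (s := uIcc 0 t)).absolutelyContinuousOnInterval).integral_deriv_eq_sub
  have e3 : ∫ s in (0:ℝ)..t, deriv (fun s => p (z s)) s = ∫ s in (0:ℝ)..t, p (g s) := by
    refine intervalIntegral.integral_congr_ae ?_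
    filter_upwards [h] with s hs hst
    exact (p.hasFDerivAt.comp_hasDerivAt s (hs hst)).deriv
  have : p (z t) = p (z 0) + p (∫ s in (0:ℝ)..t, g s) := by
    rw [← e1, ← e3, e2]; ring
  exact this

namespace HypU

variable {N M : ℕ} {A : Set (EuclideanSpace ℝ (Fin M))}
    {f : EuclideanSpace ℝ (Fin N) → EuclideanSpace ℝ (Fin M) → EuclideanSpace ℝ (Fin N)}
    {ℓ : EuclideanSpace ℝ (Fin N) → EuclideanSpace ℝ (Fin M) → ℝ}
    {Y : EuclideanSpace ℝ (Fin N) → (ℝ → EuclideanSpace ℝ (Fin M)) → ℝ →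
      EuclideanSpace ℝ (Fin N)} {L C0 C1 : ℝ} {ω : ℝ → ℝ}
    {T : Set (EuclideanSpace ℝ (Fin N))}

lemma pos_cost (H : HypU A f ℓ Y L C0 C1 ω)
    (hcl : ∀ x, IsClosed {q : EuclideanSpace ℝ (Fin N) × ℝ | ∃ a ∈ A, q = (f x a, ℓ x a)})
    (hconv : ∀ x, Convex ℝ {q : EuclideanSpace ℝ (Fin N) × ℝ | ∃ a ∈ A, q = (f x a, ℓ x a)})
    (hH5 : ∀ t > (0:ℝ), ∀ α, IsControl A α → ∀ x ∉ T, 0 < runCostU ℓ α (Y x α) t)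
    {S : Set (EuclideanSpace ℝ (Fin N))} (hS : IsCompact S) (hST : ∀ x ∈ S, x ∉ T) :
    ∃ c > 0, ∀ x ∈ S, ∀ α, IsControl A α → c ≤ costU ℓ Y x α 1 := by
  by_contra! hcon
  have hex : ∀ n : ℕ, ∃ x ∈ S, ∃ α, IsControl A α ∧ costU ℓ Y x α 1 < 1 / ((n:ℝ) + 1) :=
    fun n => hcon _ (by positivity)
  choose x hxS α hα hcost using hex
  have hL := H.hL
  have hC0 := H.C0_nn
  obtain ⟨R, hR⟩ := hS.isBounded.exists_norm_le
  have hR0 : 0 ≤ R := (norm_nonneg _).trans (hR _ (hxS 0))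
  let B := (R + C0 * 1) * Real.exp (L * 1)
  have hB : 0 ≤ B := by positivity
  let K := C0 + L * B + 1
  have hK : 0 < K := by positivity
  have hBn : ∀ n, (‖x n‖ + C0 * 1) * Real.exp (L * 1) ≤ B := fun n => by
    have := hR _ (hxS n)
    simp only [B]; gcongr
  have hlip : ∀ n s r, 0 ≤ s → s ≤ r → r ≤ 1 →
      ‖Y (x n) (α n) r - Y (x n) (α n) s‖ ≤ K * (r - s) := by
    intro n s r h0 h1 h2
    refine H.Y_lip (hα n) (x n) (τ := 1) ?_ h0 h1 h2
    have : L * ((‖x n‖ + C0 * 1) * Real.exp (L * 1)) ≤ L * B := by gcongr; exact hBn n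
    simp only [K]; linarith
  let U : Ultrafilter ℕ := hyperfilter ℕ
  have hUat : (U : Filter ℕ) ≤ atTop := by
    rw [← Nat.cofinite_eq_atTop]; exact hyperfilter_le_cofinite
  let p : ℝ → ℝ := fun t => max 0 (min t 1)
  have hp : ∀ t, p t ∈ Icc (0:ℝ) 1 := fun t => ⟨le_max_left _ _, by simp [p]⟩
  have hpid : ∀ t ∈ Icc (0:ℝ) 1, p t = t := fun t ht => by simp [p, ht.1, ht.2]
  have hpl : ∀ s t, s ≤ t → p s ≤ p t ∧ p t - p s ≤ t - s := by
    intro s t hst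
    simp only [p]
    constructor
    · gcongr
    · rcases max_cases 0 (min t 1) with ⟨h1, h2⟩ | ⟨h1, h2⟩ <;>
      rcases max_cases 0 (min s 1) with ⟨h3, h4⟩ | ⟨h3, h4⟩ <;>
      rcases min_cases t 1 with ⟨h5, h6⟩ | ⟨h5, h6⟩ <;>
      rcases min_cases s 1 with ⟨h7, h8⟩ | ⟨h7, h8⟩ <;> linarith
  have hlim : ∀ t, ∃ z, Tendsto (fun n => Y (x n) (α n) (p t)) U (𝓝 z) := by
    intro t
    obtain ⟨g, -, hg⟩ := (isCompact_closedBall (0 : EuclideanSpace ℝ (Fin N)) B).ultrafilter_le_nhds'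
      (U.map (fun n => Y (x n) (α n) (p t))) (by
      rw [Ultrafilter.mem_map]
      refine Filter.mem_of_superset (f := (U : Filter ℕ)) univ_mem fun n _ => ?_
      exact mem_closedBall_zero_iff.2 ((H.Y_bound (hα n) (x n) (τ := 1) _ (hp t)).trans (hBn n)))
    exact ⟨g, hg⟩
  choose z hz using hlim
  have hz' : ∀ s ∈ Icc (0:ℝ) 1, Tendsto (fun n => Y (x n) (α n) s) U (𝓝 (z s)) := by
    intro s hs
    have := hz s
    rwa [hpid s hs] at this
  have hzl : ∀ s t, s ≤ t → dist (z t) (z s) ≤ K * (t - s) := by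
    intro s t hst
    refine le_of_tendsto ((hz t).dist (hz s)) (Eventually.of_forall fun n => ?_)
    rw [dist_eq_norm]
    refine (hlip n _ _ (hp s).1 (hpl s t hst).1 (hp t).2).trans ?_
    have := (hpl s t hst).2
    gcongr
  have hzL : LipschitzWith ⟨K, hK.le⟩ z := by
    refine LipschitzWith.of_dist_le_mul fun s t => ?_
    rcases le_total s t with h | h
    · rw [dist_comm (z s), dist_comm s, Real.dist_eq, abs_of_nonneg (by linarith)]
      exact hzl s t h
    · rw [Real.dist_eq, abs_of_nonneg (by linarith)]
      exact hzl t s h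
  have hzc := hzL.continuous
  have hz0 : z 0 ∈ S := by
    refine hS.isClosed.mem_of_tendsto (hz' 0 ⟨le_rfl, zero_le_one⟩)
      (Eventually.of_forall fun n => ?_)
    rw [H.Y_zero (hα n)]; exact hxS n
  have hc : ∀ s ∈ Icc (0:ℝ) 1, Tendsto (fun n => costU ℓ Y (x n) (α n) s) U (𝓝 0) := by
    intro s hs
    refine Tendsto.mono_left ?_ hUat
    refine squeeze_zero (fun n => H.cost_nn (hα n) _ hs.1)
      (fun n => (H.cost_mono (hα n) _ hs.1 hs.2).trans (hcost n).le)
      tendsto_one_div_add_atTop_nhds_zero_nat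
  have hdif : ∀ᵐ t : ℝ, DifferentiableAt ℝ z t := hzL.ae_differentiableAt_real
  have hcar : CarU A (fun t a => ‖f (z t) a - deriv z t‖ + |ℓ (z t) a|) := by
    refine ⟨fun a ha => ?_, fun t => ?_, fun t a => by positivity⟩
    · have h1 : Continuous fun t => f (z t) a :=
        H.hf.comp_continuous (f := fun t => (z t, a)) (by fun_prop) (fun t => ⟨mem_univ _, ha⟩)
      have h2 : Continuous fun t => ℓ (z t) a :=
        H.hℓ.comp_continuous (f := fun t => (z t, a)) (by fun_prop) (fun t => ⟨mem_univ _, ha⟩)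
      exact ((h1.measurable.sub (measurable_deriv z)).norm).add h2.measurable.abs
    · have h1 : ContinuousOn (fun a => f (z t) a) A :=
        H.hf.comp (f := fun a => (z t, a)) (by fun_prop) (fun a ha => ⟨mem_univ _, ha⟩)
      have h2 : ContinuousOn (fun a => ℓ (z t) a) A :=
        H.hℓ.comp (f := fun a => (z t, a)) (by fun_prop) (fun a ha => ⟨mem_univ _, ha⟩)
      exact ((h1.sub continuousOn_const).norm).add h2.abs
  obtain ⟨β, hβm, hβA, hβ⟩ := hcar.select H.cl H.ne
  have hβc : IsControl A β := ⟨hβm, hβA⟩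
  have hgood : ∀ᵐ t : ℝ, t ∈ Ioc (0:ℝ) 1 →
      HasDerivAt z (f (z t) (β t)) t ∧ ℓ (z t) (β t) = 0 := by
    have hne : ∀ᵐ t : ℝ, t ≠ 1 := by simp [ae_iff]
    filter_upwards [hdif, hne] with t hd ht1 ht
    have hto : t ∈ Ioo (0:ℝ) 1 := ⟨ht.1, lt_of_le_of_ne ht.2 ht1⟩
    obtain ⟨a, ha, hae⟩ := H.incl hto (hcl _) (hconv _) (U := (U : Filter ℕ)) hα hK hlip hz' hc
      hd.hasDerivAt
    obtain ⟨e1, e2⟩ := Prod.mk.inj hae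
    have h0 := hβ t ⟨a, ha, by rw [← e1, ← e2]; simp⟩
    have n1 := norm_nonneg (f (z t) (β t) - deriv z t)
    have n2 := abs_nonneg (ℓ (z t) (β t))
    have n3 : ‖f (z t) (β t) - deriv z t‖ = 0 := by linarith
    have n4 : |ℓ (z t) (β t)| = 0 := by linarith
    rw [norm_eq_zero, sub_eq_zero] at n3
    rw [n3]
    exact ⟨hd.hasDerivAt, abs_eq_zero.1 n4⟩
  have hYz := H.uniq hβc (z 0) hzc (τ := 1) (fun t ht => by
    refine lip_ftcU hzL (H.int_f hβc hzc 0 t) ?_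
    filter_upwards [hgood] with s hs hst
    rw [uIoc_of_le ht.1] at hst
    exact (hs ⟨hst.1, hst.2.trans ht.2⟩).1)
  have := hH5 1 one_pos β hβc (z 0) (hST _ hz0)
  have hzero : runCostU ℓ β (Y (z 0) β) 1 = 0 := by
    unfold runCostU
    rw [lintegral_eq_zero_iff' ]
    · rw [EventuallyEq, ae_restrict_iff' measurableSet_Ioc]
      filter_upwards [hgood] with s hs hst
      rw [← hYz s ⟨hst.1.le, hst.2⟩, (hs hst).2]; simp
    · exact (H.meas_l hβc (H.Y_cont hβc _).measurable).ennreal_ofReal.aemeasurable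
  rw [hzero] at this
  exact lt_irrefl _ this

end HypU

namespace HypU

variable {N M : ℕ} {A : Set (EuclideanSpace ℝ (Fin M))}
    {f : EuclideanSpace ℝ (Fin N) → EuclideanSpace ℝ (Fin M) → EuclideanSpace ℝ (Fin N)}
    {ℓ : EuclideanSpace ℝ (Fin N) → EuclideanSpace ℝ (Fin M) → ℝ}
    {Y : EuclideanSpace ℝ (Fin N) → (ℝ → EuclideanSpace ℝ (Fin M)) → ℝ →
      EuclideanSpace ℝ (Fin N)} {L C0 C1 : ℝ} {ω : ℝ → ℝ}
    {T : Set (EuclideanSpace ℝ (Fin N))} {w : EuclideanSpace ℝ (Fin N) → ℝ}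

lemma near_target (H : HypU A f ℓ Y L C0 C1 ω) (hw : Continuous w)
    (hSTC : ∀ ε > (0:ℝ), T ⊆ interior {x | ∃ t, 0 ≤ t ∧ t < ε ∧
        ∃ α, IsControl A α ∧ Y x α t ∈ T})
    (hwT : ∀ x ∈ T, w x = 0) {η : ℝ} (hη : 0 < η) :
    T ⊆ interior {z | ReachU A T ℓ Y z (w z + η)} := by
  intro z0 hz0
  have hL := H.hL
  have hC0 := H.C0_nn
  have hC1 := H.C1_nn
  let B := (‖z0‖ + 1 + C0 * 1) * Real.exp (L * 1)
  have hB : 0 ≤ B := by positivity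
  have hωB : 0 ≤ ω B := by rw [← H.hω0]; exact H.hωmono hB
  let ε := min 1 (η / 2 / (C1 + ω B + 1))
  have hε : 0 < ε := by
    refine lt_min one_pos ?_
    positivity
  have h1 := mem_interior_iff_mem_nhds.1 (hSTC ε hε hz0)
  have h2 : ∀ᶠ z in 𝓝 z0, -(η / 2) < w z :=
    hw.continuousAt.eventually_const_lt (by rw [hwT z0 hz0]; linarith)
  have h3 : ∀ᶠ z in 𝓝 z0, ‖z‖ < ‖z0‖ + 1 :=
    continuous_norm.continuousAt.eventually_lt_const (by linarith)
  rw [mem_interior_iff_mem_nhds]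
  filter_upwards [h1, h2, h3] with z hz1 hz2 hz3
  obtain ⟨t, ht0, htε, α, hα, hT⟩ := hz1
  refine ⟨α, hα, t, ht0, hT, ?_⟩
  have ht1 : t ≤ 1 := htε.le.trans (min_le_left _ _)
  have hbd : ∀ s ∈ uIoc (0:ℝ) t, ‖ℓ (Y z α s) (α s)‖ ≤ C1 + ω B := by
    intro s hs
    rw [uIoc_of_le ht0] at hs
    have hb := H.Y_bound hα z (τ := 1) s ⟨hs.1.le, hs.2.trans ht1⟩
    have hb' : ‖Y z α s‖ ≤ B := hb.trans (by simp only [B]; gcongr)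
    rw [Real.norm_eq_abs, abs_of_nonneg (H.hℓnn _ _ (hα.2 s))]
    have := H.l_le (Y z α s) (hα.2 s)
    have := H.hωmono hb'
    linarith
  have hc := intervalIntegral.norm_integral_le_of_norm_le_const hbd
  rw [sub_zero, abs_of_nonneg ht0] at hc
  have hc' : costU ℓ Y z α t ≤ (C1 + ω B) * t := (le_abs_self _).trans hc
  have h5 : (C1 + ω B) * t ≤ (C1 + ω B + 1) * (η / 2 / (C1 + ω B + 1)) := by
    have := htε.le.trans (min_le_right _ _)
    exact mul_le_mul (by linarith) this ht0 (by linarith)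
  have h6 : (C1 + ω B + 1) * (η / 2 / (C1 + ω B + 1)) = η / 2 := by field_simp
  linarith

/-- Concatenation of countably many controls on unit intervals. -/
def concU (b : ℕ → ℝ → EuclideanSpace ℝ (Fin M)) (t : ℝ) : EuclideanSpace ℝ (Fin M) :=
  b (⌈t⌉₊ - 1) (t - ((⌈t⌉₊ - 1 : ℕ) : ℝ))

lemma conc_ctl {b : ℕ → ℝ → EuclideanSpace ℝ (Fin M)} (hb : ∀ n, IsControl A (b n)) :
    IsControl A (concU b) := by
  refine ⟨?_, fun t => (hb _).2 _⟩
  have hk : Measurable fun t : ℝ => ⌈t⌉₊ - 1 :=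
    (measurable_from_top (f := fun n : ℕ => n - 1)).comp Nat.measurable_ceil
  have hu : Measurable fun q : ℕ × ℝ => b q.1 q.2 :=
    measurable_from_prod_countable_right fun n => (hb n).1
  have hcast : Measurable fun t : ℝ => ((⌈t⌉₊ - 1 : ℕ) : ℝ) :=
    (measurable_from_top (f := fun n : ℕ => (n : ℝ))).comp hk
  exact hu.comp (hk.prodMk (measurable_id.sub hcast))

lemma conc_eq (b : ℕ → ℝ → EuclideanSpace ℝ (Fin M)) (n : ℕ) {s : ℝ} (hs : s ∈ Ioc (0:ℝ) 1) :
    concU b (n + s) = b n s := by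
  have : ⌈(n:ℝ) + s⌉₊ = n + 1 := by
    rw [Nat.ceil_eq_iff (by omega)]
    constructor
    · simp; exact hs.1
    · push_cast; linarith [hs.2]
  unfold concU
  rw [this]
  simp

lemma reach (H : HypU A f ℓ Y L C0 C1 ω) (hT : IsClosed T) (hw : Continuous w)
    (hcl : ∀ x, IsClosed {q : EuclideanSpace ℝ (Fin N) × ℝ | ∃ a ∈ A, q = (f x a, ℓ x a)})
    (hconv : ∀ x, Convex ℝ {q : EuclideanSpace ℝ (Fin N) × ℝ | ∃ a ∈ A, q = (f x a, ℓ x a)})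
    (hSTC : ∀ ε > (0:ℝ), T ⊆ interior {x | ∃ t, 0 ≤ t ∧ t < ε ∧
        ∃ α, IsControl A α ∧ Y x α t ∈ T})
    (hH5 : ∀ t > (0:ℝ), ∀ α, IsControl A α → ∀ x ∉ T, 0 < runCostU ℓ α (Y x α) t)
    (hH6 : ∀ x α, IsControl A α →
        (∀ C : ℝ, ∀ t : ℝ, ∃ s, t ≤ s ∧ C < ‖Y x α s‖) →
        (∫⁻ s in Ioi (0:ℝ), ENNReal.ofReal (ℓ (Y x α s) (α s))) = ⊤)
    (hsol : IsViscositySolU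
      (fun x p => ⨆ a : A,
        (-(inner (𝕜 := ℝ) (f x (a : EuclideanSpace ℝ (Fin M))) p : ℝ) -
          ℓ x (a : EuclideanSpace ℝ (Fin M)))) Tᶜ w)
    (hbb : BddBelow (range w))
    (hwT : ∀ x ∈ T, w x = 0) (x : EuclideanSpace ℝ (Fin N)) {η : ℝ} (hη : 0 < η) :
    ReachU A T ℓ Y x (w x + 2 * η) := by
  by_contra hno
  set O := interior {z | ReachU A T ℓ Y z (w z + η)} with hO
  have hTO : T ⊆ O := H.near_target hw hSTC hwT hη
  have hOr : ∀ z ∈ O, ReachU A T ℓ Y z (w z + η) := fun z hz =>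
    (interior_subset hz : z ∈ {z | ReachU A T ℓ Y z (w z + η)})
  have hex : ∀ (z : EuclideanSpace ℝ (Fin N)) (δ : ℝ), ∃ α, IsControl A α ∧
      (0 < δ → ¬ ReachU A T ℓ Y z (w z + η + δ) →
        w (Y z α 1) + costU ℓ Y z α 1 ≤ w z + δ) := by
    intro z δ
    by_cases h : 0 < δ ∧ ¬ ReachU A T ℓ Y z (w z + η + δ)
    · obtain ⟨α, h1, h2⟩ := H.super_one hT hw hsol isOpen_interior hTO hOr h.1 h.2
      exact ⟨α, h1, fun _ _ => h2⟩
    · obtain ⟨a, ha⟩ := H.ne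
      exact ⟨fun _ => a, const_ctl ha, fun h1 h2 => absurd ⟨h1, h2⟩ h⟩
  choose ctl hctl hctl' using hex
  let X : ℕ → EuclideanSpace ℝ (Fin N) := fun n =>
    Nat.rec x (fun n z => Y z (ctl z (η / 2 ^ (n + 1))) 1) n
  let b : ℕ → ℝ → EuclideanSpace ℝ (Fin M) := fun n => ctl (X n) (η / 2 ^ (n + 1))
  have hb : ∀ n, IsControl A (b n) := fun n => hctl _ _
  have hX0 : X 0 = x := rfl
  have hXs : ∀ n, X (n + 1) = Y (X n) (b n) 1 := fun n => rfl
  have half : ∀ n : ℕ, η / 2 ^ (n + 1) + η / 2 ^ (n + 1) = η / 2 ^ n := fun n => by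
    rw [pow_succ]; field_simp; ring
  have hpos : ∀ n : ℕ, 0 < η / 2 ^ n := fun n => by positivity
  have hstep : ∀ n, ¬ ReachU A T ℓ Y (X n) (w (X n) + η + η / 2 ^ n) →
      w (X (n + 1)) + costU ℓ Y (X n) (b n) 1 ≤ w (X n) + η / 2 ^ (n + 1) := by
    intro n hn
    refine hctl' (X n) _ (hpos _) fun h => hn (reach_mono ?_ h)
    have := half n
    have := hpos (n + 1)
    linarith
  have hinv : ∀ n, ¬ ReachU A T ℓ Y (X n) (w (X n) + η + η / 2 ^ n) := by
    intro n
    induction n with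
    | zero =>
      intro h
      refine hno (reach_mono ?_ h)
      rw [hX0]; simp; linarith
    | succ n ih =>
      intro h
      have h1 := hstep n ih
      rw [hXs] at h h1
      refine ih (reach_mono ?_ (H.reach_cat (hb n) zero_le_one h))
      have := half n
      linarith
  have hXO : ∀ n, X n ∉ O := fun n h => hinv n (reach_mono (by linarith [hpos n]) (hOr _ h))
  have hα : IsControl A (concU b) := conc_ctl hb
  set α := concU b with hαdef
  have hshift : ∀ (n : ℕ), ∀ s ∈ Ioc (0:ℝ) 1, (fun s => α ((n:ℝ) + s)) s = b n s :=
    fun n s hs => conc_eq b n hs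
  have one_mem : (1:ℝ) ∈ Icc (0:ℝ) 1 := ⟨zero_le_one, le_rfl⟩
  have hmain : ∀ n : ℕ, Y x α n = X n ∧
      w (X n) + costU ℓ Y x α n ≤ w x + η - η / 2 ^ n := by
    intro n
    induction n with
    | zero =>
      refine ⟨by simp [H.Y_zero hα, hX0], ?_⟩
      simp [costU, hX0]
    | succ n ih =>
      have hn : (0:ℝ) ≤ n := by positivity
      have e1 := H.Y_shift hα x hn zero_le_one
      have e2 := H.cost_shift hα x hn zero_le_one
      have c1 := H.Y_congr (shift_ctl hα n) (hb n) (X n) (hshift n) 1 one_mem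
      have c2 := H.cost_congr (shift_ctl hα n) (hb n) (X n) (hshift n) 1 one_mem
      rw [ih.1] at e1 e2
      push_cast
      rw [← e1, e2, c1, c2]
      refine ⟨(hXs n).symm, ?_⟩
      have := hstep n (hinv n)
      have := half n
      linarith [ih.2]
  obtain ⟨m, hm⟩ := hbb
  have hm' : ∀ z, m ≤ w z := fun z => hm (mem_range_self z)
  have hcb : ∀ n : ℕ, costU ℓ Y x α n ≤ w x + η - m := by
    intro n
    have := (hmain n).2
    have := hm' (X n)
    have := hpos n
    linarith
  have hlt : (∫⁻ s in Ioi (0:ℝ), ENNReal.ofReal (ℓ (Y x α s) (α s))) ≠ ⊤ := by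
    have e : Ioi (0:ℝ) = ⋃ n : ℕ, Ioc (0:ℝ) n := by
      ext s
      simp only [mem_Ioi, mem_iUnion, mem_Ioc]
      constructor
      · intro hs
        obtain ⟨n, hn⟩ := exists_nat_ge s
        exact ⟨n, hs, hn⟩
      · rintro ⟨n, h, -⟩; exact h
    rw [e, setLIntegral_iUnion_of_directed]
    · refine ne_top_of_le_ne_top (b := ENNReal.ofReal (w x + η - m)) ENNReal.ofReal_ne_top
        (iSup_le fun n => ?_)
      have := H.runCost_eq hα x (t := n) (by positivity)
      unfold runCostU at this
      rw [this]
      exact ENNReal.ofReal_le_ofReal (hcb n)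
    · refine Monotone.directed_le fun i j hij => Ioc_subset_Ioc_right (by exact_mod_cast hij)
  have hbd : ∃ C t : ℝ, ∀ s, t ≤ s → ‖Y x α s‖ ≤ C := by
    by_contra! h
    exact hlt (hH6 x α hα h)
  obtain ⟨C, t, hC⟩ := hbd
  obtain ⟨c, hc, hpc⟩ := H.pos_cost hcl hconv hH5
    ((isCompact_closedBall (0 : EuclideanSpace ℝ (Fin N)) C).diff isOpen_interior (t := O))
    (fun y hy hyT => hy.2 (hTO hyT))
  obtain ⟨n0, hn0⟩ := exists_nat_ge t
  have hgrow : ∀ k : ℕ, k * c ≤ costU ℓ Y x α ((n0 + k : ℕ) : ℝ) := by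
    intro k
    induction k with
    | zero => simp only [Nat.cast_zero, zero_mul]; exact H.cost_nn hα x (by positivity)
    | succ k ih =>
      have hn : (0:ℝ) ≤ ((n0 + k : ℕ) : ℝ) := by positivity
      have e2 := H.cost_shift hα x hn zero_le_one
      have hmem : Y x α ((n0 + k : ℕ) : ℝ) ∈ closedBall 0 C \ O := by
        constructor
        · refine mem_closedBall_zero_iff.2 (hC _ (hn0.trans ?_))
          push_cast; linarith [Nat.cast_nonneg (α := ℝ) k]
        · rw [(hmain _).1]; exact hXO _
      have := hpc _ hmem _ (shift_ctl hα ((n0 + k : ℕ) : ℝ))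
      have e3 : ((n0 + (k + 1) : ℕ) : ℝ) = ((n0 + k : ℕ) : ℝ) + 1 := by push_cast; ring
      rw [e3, e2]
      push_cast at *
      linarith
  obtain ⟨k, hk⟩ := exists_nat_gt ((w x + η - m) / c)
  rw [div_lt_iff₀ hc] at hk
  linarith [hgrow k, hcb (n0 + k)]

lemma le_cost (H : HypU A f ℓ Y L C0 C1 ω) (hT : IsClosed T) (hw : Continuous w)
    (hsol : IsViscositySolU
      (fun x p => ⨆ a : A,
        (-(inner (𝕜 := ℝ) (f x (a : EuclideanSpace ℝ (Fin M))) p : ℝ) -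
          ℓ x (a : EuclideanSpace ℝ (Fin M)))) Tᶜ w)
    (hwT : ∀ x ∈ T, w x = 0) (x : EuclideanSpace ℝ (Fin N)) {α} (hα : IsControl A α)
    (hne : (exitTimesU T (Y x α)).Nonempty) :
    0 ≤ sInf (exitTimesU T (Y x α)) ∧
    w x ≤ costU ℓ Y x α (sInf (exitTimesU T (Y x α))) := by
  have hc := H.Y_cont hα x
  have hb : BddBelow (exitTimesU T (Y x α)) := ⟨0, fun t ht => ht.1⟩
  have hclo : IsClosed (exitTimesU T (Y x α)) :=
    isClosed_Ici.inter (hT.preimage hc)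
  have hmem := hclo.csInf_mem hne hb
  set τ := sInf (exitTimesU T (Y x α)) with hτ
  refine ⟨hmem.1, ?_⟩
  have hlt : ∀ t ∈ Ico 0 τ, Y x α t ∉ T := fun t ht h =>
    absurd (csInf_le hb (show t ∈ exitTimesU T (Y x α) from ⟨ht.1, h⟩)) (not_le.2 ht.2)
  rcases hmem.1.eq_or_lt with h0 | h0
  · have h1 := hmem.2
    rw [← h0, H.Y_zero hα] at h1
    rw [← h0, hwT x h1]
    simp [costU]
  · have key : ∀ᶠ t in 𝓝[<] τ, w x ≤ w (Y x α t) + costU ℓ Y x α τ := by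
      have e1 : ∀ᶠ t in 𝓝[<] τ, 0 < t := nhdsWithin_le_nhds (eventually_gt_nhds h0)
      filter_upwards [e1, self_mem_nhdsWithin] with t ht htτ
      have htτ : t < τ := htτ
      have := H.subopt hT hw hsol hα ht (fun s hs => hlt s ⟨hs.1, hs.2.trans_lt htτ⟩)
      have := H.cost_mono hα x ht.le htτ.le
      linarith
    have hlim : Tendsto (fun t => w (Y x α t) + costU ℓ Y x α τ) (𝓝[<] τ)
        (𝓝 (w (Y x α τ) + costU ℓ Y x α τ)) :=
      (((hw.comp hc).tendsto τ).mono_left nhdsWithin_le_nhds).add_const _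
    have := ge_of_tendsto hlim key
    rwa [hwT _ hmem.2, zero_add] at this

end HypU

/-- uniqueness for unbounded control sets via vector-field-valued
controls.  Under the convexity of the velocity-cost sets, `(STCT)`, `(H₅)`, `(H₆)`,
the local boundedness `(H₇)` of `f`, the modulus condition `(H₈)`, `(NC₁)`
(`sup_{u∈A} ℓ(0,u) < ∞`) and `(NC₂)` (the family `{(f(·,u), ℓ(·,u)) : u ∈ A}` is closed
in `C(ℝ^N, ℝ^N × ℝ)` with the compact-open topology, i.e. compact convergence), any
continuous bounded-from-below viscosity solution `w` of
`sup_{a ∈ A} {−f(x,a)·Dw(x) − ℓ(x,a)} = 0` on `ℝ^N ∖ T` vanishing on `T` equals the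
value function `v`. -/
theorem unbounded_controls_vector_fields {N M : ℕ}
    (A : Set (EuclideanSpace ℝ (Fin M))) (hAcl : IsClosed A) (hAne : A.Nonempty)
    (f : EuclideanSpace ℝ (Fin N) → EuclideanSpace ℝ (Fin M) → EuclideanSpace ℝ (Fin N))
    (ℓ : EuclideanSpace ℝ (Fin N) → EuclideanSpace ℝ (Fin M) → ℝ)
    (hconv : ∀ x, Convex ℝ {q : EuclideanSpace ℝ (Fin N) × ℝ | ∃ a ∈ A, q = (f x a, ℓ x a)})
    (T : Set (EuclideanSpace ℝ (Fin N))) (hTcl : IsClosed T) (hTne : T.Nonempty)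
    (hf : ContinuousOn (fun q : EuclideanSpace ℝ (Fin N) × EuclideanSpace ℝ (Fin M) =>
      f q.1 q.2) (univ ×ˢ A))
    (L : ℝ) (hL : 0 < L)
    (hfLip : ∀ x y, ∀ a ∈ A, ‖f x a - f y a‖ ≤ L * ‖x - y‖)
    (hℓ : ContinuousOn (fun q : EuclideanSpace ℝ (Fin N) × EuclideanSpace ℝ (Fin M) =>
      ℓ q.1 q.2) (univ ×ˢ A))
    (hℓnn : ∀ x, ∀ a ∈ A, 0 ≤ ℓ x a)
    (Y : EuclideanSpace ℝ (Fin N) → (ℝ → EuclideanSpace ℝ (Fin M)) → ℝ →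
      EuclideanSpace ℝ (Fin N))
    (hY : ∀ x α, IsControl A α → IsTrajectoryU f α x (Y x α))
    (hSTC : ∀ ε > (0:ℝ), T ⊆ interior {x | ∃ t, 0 ≤ t ∧ t < ε ∧
        ∃ α, IsControl A α ∧ Y x α t ∈ T})
    (hH5 : ∀ t > (0:ℝ), ∀ α, IsControl A α → ∀ x ∉ T, 0 < runCostU ℓ α (Y x α) t)
    (hH6 : ∀ x α, IsControl A α →
        (∀ C : ℝ, ∀ t : ℝ, ∃ s, t ≤ s ∧ C < ‖Y x α s‖) →
        (∫⁻ s in Ioi (0:ℝ), ENNReal.ofReal (ℓ (Y x α s) (α s))) = ⊤)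
    (hH7 : ∀ R > (0:ℝ), ∃ C : ℝ, ∀ x ∈ Metric.ball (0 : EuclideanSpace ℝ (Fin N)) R,
        ∀ a ∈ A, ‖f x a‖ ≤ C)
    (ω : ℝ → ℝ) (hωc : Continuous ω) (hωmono : Monotone ω) (hω0 : ω 0 = 0)
    (hωnn : ∀ r, 0 ≤ ω r)
    (hH8 : ∀ x y, ∀ u ∈ A, |ℓ x u - ℓ y u| ≤ ω ‖x - y‖)
    -- (NC₁): `sup {ℓ(0,u) : u ∈ A} < ∞`
    (hNC1 : BddAbove (range fun a : A => ℓ 0 (a : EuclideanSpace ℝ (Fin M))))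
    -- (NC₂): `{(f(·,u), ℓ(·,u)) : u ∈ A}` is closed in `C(ℝ^N, ℝ^N × ℝ)` with the
    -- topology of compact convergence (the compact-open topology)
    (Fb : A → C(EuclideanSpace ℝ (Fin N), EuclideanSpace ℝ (Fin N) × ℝ))
    (hFb : ∀ (a : A) (x : EuclideanSpace ℝ (Fin N)),
      Fb a x = (f x (a : EuclideanSpace ℝ (Fin M)), ℓ x (a : EuclideanSpace ℝ (Fin M))))
    (hNC2 : IsClosed (range Fb))
    (w : EuclideanSpace ℝ (Fin N) → ℝ) (hw : Continuous w)
    (hsol : IsViscositySolU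
      (fun x p => ⨆ a : A,
        (-(inner (𝕜 := ℝ) (f x (a : EuclideanSpace ℝ (Fin M))) p : ℝ) -
          ℓ x (a : EuclideanSpace ℝ (Fin M)))) Tᶜ w)
    (hbb : BddBelow (range w))
    (hwT : ∀ x ∈ T, w x = 0) :
    ∀ x, (w x : EReal) = valueFnU A T ℓ Y x := by
  obtain ⟨C0, hC0⟩ := hH7 1 one_pos
  obtain ⟨C1, hC1⟩ := hNC1
  have H : HypU A f ℓ Y L C0 C1 ω :=
    { ne := hAne
      cl := hAcl
      hf := hf
      hL := hL
      hfLip := hfLip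
      hℓ := hℓ
      hℓnn := hℓnn
      hY := hY
      hωc := hωc
      hωmono := hωmono
      hω0 := hω0
      hH8 := hH8
      hC0 := fun a ha => hC0 0 (Metric.mem_ball_self one_pos) a ha
      hC1 := fun a ha => hC1 ⟨⟨a, ha⟩, rfl⟩ }
  have hcl := H.D_closed Fb hFb hNC2
  intro x
  apply le_antisymm
  · refine le_sInf ?_
    rintro c ⟨α, hα, hne, rfl⟩
    obtain ⟨h0, h1⟩ := H.le_cost hTcl hw hsol hwT x hα hne
    rw [H.runCost_eq hα x h0, EReal.coe_ennreal_ofReal, max_eq_left (H.cost_nn hα x h0)]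
    exact_mod_cast h1
  · refine EReal.le_of_forall_lt_iff_le.1 fun r hr => ?_
    have hr' : w x < r := by exact_mod_cast hr
    obtain ⟨α, hα, t, ht, hYT, hcost⟩ := H.reach hTcl hw hcl hconv hSTC hH5 hH6 hsol hbb hwT x
      (η := (r - w x) / 2) (by linarith)
    have hmem : t ∈ exitTimesU T (Y x α) := ⟨ht, hYT⟩
    unfold valueFnU
    refine le_trans (sInf_le (a := ((runCostU ℓ α (Y x α) (sInf (exitTimesU T (Y x α))) : ℝ≥0∞) : EReal))
      ⟨α, hα, ⟨t, hmem⟩, rfl⟩) ?_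
    have hle : sInf (exitTimesU T (Y x α)) ≤ t := csInf_le ⟨0, fun t ht => ht.1⟩ hmem
    have h0 : 0 ≤ sInf (exitTimesU T (Y x α)) := le_csInf ⟨t, hmem⟩ fun t ht => ht.1
    rw [H.runCost_eq hα x h0, EReal.coe_ennreal_ofReal, max_eq_left (H.cost_nn hα x h0)]
    have := H.cost_mono hα x h0 hle
    have h2 : costU ℓ Y x α (sInf (exitTimesU T (Y x α))) ≤ r := by linarith
    exact_mod_cast h2
end
end

section
/- Consider the Fuller Problem: control set A = [−1,1], target T = {(0,0)} ⊆ ℝ², dynamics f(x,y,a) = (y,a), Lagrangian ℓ(x,y,a) = x², with value function v₀. Then: (1) v₀ is finite and convex on ℝ² (hence continuous); and (2) the function w(x,y) := −v₀(−x,y) is a viscosity solution of −y·(Dw(x,y))₁ + |(Dw(x,y))₂| − x² = 0 on ℝ² ∖ {(0,0)} with w(0,0) = 0. Consequently, the boundedness-from-below hypothesis in the uniqueness theorem for this HJBE cannot be removed. -/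
open MeasureTheory Set Filter Topology Metric
open scoped RealInnerProductSpace ENNReal

noncomputable section

/-- The set of relaxed controls: measurable families `t ↦ β t` of Radon probability
measures on the control space `A` (measurability in the weak-* sense). -/
def IsRelaxedControl {A : Type*} [MetricSpace A] [MeasurableSpace A]
    (β : ℝ → Measure A) : Prop :=
  (∀ t, IsProbabilityMeasure (β t)) ∧
    ∀ g : C(A, ℝ), Measurable fun t => ∫ a, g a ∂(β t)

/-- `y` is the trajectory of `ẏ = f^r(y, β)` with `y 0 = x` (integral form). -/
def IsTrajectory {N : ℕ} {A : Type*} [MeasurableSpace A]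
    (f : EuclideanSpace ℝ (Fin N) → A → EuclideanSpace ℝ (Fin N))
    (β : ℝ → Measure A) (x : EuclideanSpace ℝ (Fin N))
    (y : ℝ → EuclideanSpace ℝ (Fin N)) : Prop :=
  y 0 = x ∧ Continuous y ∧
    ∀ t, 0 ≤ t → y t = x + ∫ s in (0:ℝ)..t, ∫ a, f (y s) a ∂(β s)

/-- The set of times `t ≥ 0` at which the trajectory `y` lies in the target `T`;
its infimum is the exit time `t_x(β)`, and `t_x(β) < ∞` iff this set is nonempty. -/
def exitTimes {N : ℕ} (T : Set (EuclideanSpace ℝ (Fin N)))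
    (y : ℝ → EuclideanSpace ℝ (Fin N)) : Set ℝ :=
  {t : ℝ | 0 ≤ t ∧ y t ∈ T}

/-- The running cost `∫₀^t ℓ^r(y(s), β(s)) ds`, as an extended nonnegative real. -/
def runCost {N : ℕ} {A : Type*} [MeasurableSpace A]
    (ℓ : EuclideanSpace ℝ (Fin N) → A → ℝ) (β : ℝ → Measure A)
    (y : ℝ → EuclideanSpace ℝ (Fin N)) (t : ℝ) : ℝ≥0∞ :=
  ∫⁻ s in Ioc (0:ℝ) t, ENNReal.ofReal (∫ a, ℓ (y s) a ∂(β s))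

/-- The value function `v(x)` of the exit time problem, as an extended real
(`+∞` when no relaxed control brings `x` to the target in finite time). -/
def valueFn {N : ℕ} {A : Type*} [MetricSpace A] [MeasurableSpace A]
    (T : Set (EuclideanSpace ℝ (Fin N))) (ℓ : EuclideanSpace ℝ (Fin N) → A → ℝ)
    (Y : EuclideanSpace ℝ (Fin N) → (ℝ → Measure A) → ℝ → EuclideanSpace ℝ (Fin N))
    (x : EuclideanSpace ℝ (Fin N)) : EReal :=
  sInf { c : EReal | ∃ β : ℝ → Measure A, IsRelaxedControl β ∧
      (exitTimes T (Y x β)).Nonempty ∧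
      c = ((runCost ℓ β (Y x β) (sInf (exitTimes T (Y x β)))) : EReal) }

/-- Viscosity solution of `F(x, Dw(x)) = 0` on the open set `G`, via `C¹` test functions. -/
def IsViscositySol {N : ℕ}
    (F : EuclideanSpace ℝ (Fin N) → EuclideanSpace ℝ (Fin N) → ℝ)
    (G : Set (EuclideanSpace ℝ (Fin N))) (w : EuclideanSpace ℝ (Fin N) → ℝ) : Prop :=
  (∀ γ : EuclideanSpace ℝ (Fin N) → ℝ, ContDiffOn ℝ 1 γ G → ∀ x₀ ∈ G,
      IsLocalMinOn (fun x => w x - γ x) G x₀ → 0 ≤ F x₀ (gradient γ x₀)) ∧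
  (∀ γ : EuclideanSpace ℝ (Fin N) → ℝ, ContDiffOn ℝ 1 γ G → ∀ x₁ ∈ G,
      IsLocalMaxOn (fun x => w x - γ x) G x₁ → F x₁ (gradient γ x₁) ≤ 0)

/-- The Hamiltonian `sup_{m ∈ A^r} { −f^r(x,m)·p − ℓ^r(x,m) }` of the HJBE. -/
def HJB {N : ℕ} {A : Type*} [MetricSpace A] [MeasurableSpace A]
    (f : EuclideanSpace ℝ (Fin N) → A → EuclideanSpace ℝ (Fin N))
    (ℓ : EuclideanSpace ℝ (Fin N) → A → ℝ)
    (x p : EuclideanSpace ℝ (Fin N)) : ℝ :=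
  ⨆ m : ProbabilityMeasure A,
    (-(inner (𝕜 := ℝ) (∫ a, f x a ∂(m : Measure A)) p : ℝ) - ∫ a, ℓ x a ∂(m : Measure A))


instance : Nonempty (Icc (-1:ℝ) 1) := ⟨⟨0, by norm_num⟩⟩

namespace Fuller

/-- admissible scalar controls -/
def Ctrl (u : ℝ → ℝ) : Prop := Measurable u ∧ ∀ s, |u s| ≤ 1

/-- velocity -/
def vel (y : ℝ) (u : ℝ → ℝ) (t : ℝ) : ℝ := y + ∫ s in (0:ℝ)..t, u s

/-- position -/
def pos (x y : ℝ) (u : ℝ → ℝ) (t : ℝ) : ℝ := x + ∫ s in (0:ℝ)..t, vel y u s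

/-- cost -/
def cost (x y : ℝ) (u : ℝ → ℝ) (t : ℝ) : ℝ := ∫ s in (0:ℝ)..t, (pos x y u s)^2

/-- the control `u` steers to the origin at time `T` -/
def Adm (x y : ℝ) (u : ℝ → ℝ) (T : ℝ) : Prop :=
  Ctrl u ∧ 0 ≤ T ∧ pos x y u T = 0 ∧ vel y u T = 0

/-- set of costs -/
def costs (x y : ℝ) : Set ℝ := {c | ∃ u T, Adm x y u T ∧ c = cost x y u T}

/-- real value function -/
def val (x y : ℝ) : ℝ := sInf (costs x y)

/-- concatenation -/
def cat (u : ℝ → ℝ) (T : ℝ) (u' : ℝ → ℝ) (s : ℝ) : ℝ := if s < T then u s else u' (s - T)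

lemma Ctrl.ii {u : ℝ → ℝ} (hu : Ctrl u) (a b : ℝ) : IntervalIntegrable u volume a b := by
  rw [intervalIntegrable_iff]
  refine Measure.integrableOn_of_bounded (M := 1) (by simp) hu.1.aestronglyMeasurable ?_
  exact ae_of_all _ (fun s => by simpa using hu.2 s)

lemma Ctrl.vel_cont {u : ℝ → ℝ} (hu : Ctrl u) (y : ℝ) : Continuous (vel y u) := by
  unfold vel
  exact continuous_const.add (intervalIntegral.continuous_primitive (fun a b => hu.ii a b) 0)

lemma Ctrl.pos_cont {u : ℝ → ℝ} (hu : Ctrl u) (x y : ℝ) : Continuous (pos x y u) := by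
  unfold pos
  exact continuous_const.add
    (intervalIntegral.continuous_primitive (fun a b => (hu.vel_cont y).intervalIntegrable a b) 0)

lemma Ctrl.shift {u : ℝ → ℝ} (hu : Ctrl u) (h : ℝ) : Ctrl (fun s => u (h + s)) :=
  ⟨hu.1.comp (measurable_const.add measurable_id), fun s => hu.2 _⟩

lemma Ctrl.cat {u u' : ℝ → ℝ} (hu : Ctrl u) (hu' : Ctrl u') (h : ℝ) : Ctrl (cat u h u') := by
  refine ⟨?_, fun s => ?_⟩
  · unfold Fuller.cat
    exact Measurable.ite measurableSet_Iio hu.1 (hu'.1.comp (measurable_id.sub measurable_const))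
  · unfold Fuller.cat
    split_ifs
    · exact hu.2 _
    · exact hu'.2 _

lemma Ctrl.zero : Ctrl (fun _ => 0) := ⟨measurable_const, fun s => by simp⟩

/-- equality of integrals for functions agreeing on the open interval -/
lemma ii_congr {f g : ℝ → ℝ} {t : ℝ} (ht : 0 ≤ t) (h : ∀ s, 0 < s → s < t → f s = g s) :
    ∫ s in (0:ℝ)..t, f s = ∫ s in (0:ℝ)..t, g s := by
  rw [intervalIntegral.integral_of_le ht, intervalIntegral.integral_of_le ht,
    integral_Ioc_eq_integral_Ioo, integral_Ioc_eq_integral_Ioo]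
  exact setIntegral_congr_fun measurableSet_Ioo (fun s hs => h s hs.1 hs.2)

lemma vel_congr {u u' : ℝ → ℝ} {T : ℝ} (h : ∀ s, 0 < s → s < T → u s = u' s) (y : ℝ) {t : ℝ}
    (ht : 0 ≤ t) (htT : t ≤ T) : vel y u t = vel y u' t := by
  unfold vel
  rw [ii_congr ht (fun s h1 h2 => h s h1 (h2.trans_le htT))]

lemma pos_congr {u u' : ℝ → ℝ} {T : ℝ} (h : ∀ s, 0 < s → s < T → u s = u' s) (x y : ℝ) {t : ℝ}
    (ht : 0 ≤ t) (htT : t ≤ T) : pos x y u t = pos x y u' t := by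
  unfold pos
  rw [ii_congr ht (fun s h1 h2 => vel_congr h y h1.le (h2.le.trans htT))]

lemma cost_congr {u u' : ℝ → ℝ} {T : ℝ} (h : ∀ s, 0 < s → s < T → u s = u' s) (x y : ℝ) {t : ℝ}
    (ht : 0 ≤ t) (htT : t ≤ T) : cost x y u t = cost x y u' t := by
  unfold cost
  rw [ii_congr ht (fun s h1 h2 => by rw [pos_congr h x y h1.le (h2.le.trans htT)])]

lemma vel_shift {u : ℝ → ℝ} (hu : Ctrl u) (y h t : ℝ) :
    vel y u (h + t) = vel (vel y u h) (fun s => u (h + s)) t := by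
  unfold vel
  rw [intervalIntegral.integral_comp_add_left (fun s => u s) h,
    ← intervalIntegral.integral_add_adjacent_intervals (hu.ii 0 h) (hu.ii h (h + t))]
  simp [add_assoc]

lemma pos_shift {u : ℝ → ℝ} (hu : Ctrl u) (x y h t : ℝ) :
    pos x y u (h + t) = pos (pos x y u h) (vel y u h) (fun s => u (h + s)) t := by
  unfold pos
  simp only [← vel_shift hu]
  rw [intervalIntegral.integral_comp_add_left (fun s => vel y u s) h,
    ← intervalIntegral.integral_add_adjacent_intervals
      ((hu.vel_cont y).intervalIntegrable 0 h) ((hu.vel_cont y).intervalIntegrable h (h + t))]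
  simp [add_assoc]

lemma cost_shift {u : ℝ → ℝ} (hu : Ctrl u) (x y h t : ℝ) :
    cost x y u (h + t) = cost x y u h +
      cost (pos x y u h) (vel y u h) (fun s => u (h + s)) t := by
  unfold cost
  simp only [← pos_shift hu]
  rw [intervalIntegral.integral_comp_add_left (fun s => (pos x y u s)^2) h,
    ← intervalIntegral.integral_add_adjacent_intervals
      (f := fun s => (pos x y u s)^2)
      (((hu.pos_cont x y).pow 2).intervalIntegrable 0 h)
      (((hu.pos_cont x y).pow 2).intervalIntegrable h (h + t))]
  simp

lemma cost_nonneg {x y : ℝ} {u : ℝ → ℝ} {t : ℝ} (ht : 0 ≤ t) : 0 ≤ cost x y u t :=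
  intervalIntegral.integral_nonneg ht (fun s _ => sq_nonneg _)

lemma cost_mono {x y : ℝ} {u : ℝ → ℝ} (hu : Ctrl u) {s t : ℝ} (hst : s ≤ t) :
    cost x y u s ≤ cost x y u t := by
  have := cost_shift hu x y s (t - s)
  have h2 := cost_nonneg (x := pos x y u s) (y := vel y u s) (u := fun r => u (s + r))
    (sub_nonneg.2 hst)
  rw [add_sub_cancel] at this
  linarith

/-- concatenation lemma -/
lemma cat_adm {x y : ℝ} {u u' : ℝ → ℝ} {h T : ℝ} (hu : Ctrl u) (hh : 0 ≤ h)
    (H : Adm (pos x y u h) (vel y u h) u' T) :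
    Adm x y (cat u h u') (h + T) ∧
    cost x y (cat u h u') (h + T) = cost x y u h + cost (pos x y u h) (vel y u h) u' T := by
  obtain ⟨hu', hT, h1, h2⟩ := H
  have hc := hu.cat hu' h
  have e : ∀ s, 0 < s → s < h → cat u h u' s = u s := fun s _ h => by simp [cat, h]
  have e2 : ∀ s, 0 < s → s < T → (fun s => cat u h u' (h + s)) s = u' s := fun s hs _ => by
    simp [cat, not_lt.2 hs.le]
  have ev := vel_congr e y hh le_rfl
  have ep := pos_congr e x y hh le_rfl
  have ec := cost_congr e x y hh le_rfl
  refine ⟨⟨hc, by linarith, ?_, ?_⟩, ?_⟩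
  · rw [pos_shift hc, ev, ep, pos_congr e2 _ _ hT le_rfl, h1]
  · rw [vel_shift hc, ev, vel_congr e2 _ hT le_rfl, h2]
  · rw [cost_shift hc, ev, ep, ec, cost_congr e2 _ _ hT le_rfl]

lemma costs_bdd (x y : ℝ) : BddBelow (costs x y) :=
  ⟨0, by rintro c ⟨u, T, h, rfl⟩; exact cost_nonneg h.2.1⟩

lemma val_le {x y : ℝ} {u : ℝ → ℝ} {T : ℝ} (h : Adm x y u T) : val x y ≤ cost x y u T :=
  csInf_le (costs_bdd x y) ⟨u, T, h, rfl⟩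

lemma vel_lin (y a b t : ℝ) : vel y (fun s => a + b * s) t = y + a * t + b * t^2 / 2 := by
  unfold vel
  rw [intervalIntegral.integral_add (by simp) (Continuous.intervalIntegrable (by fun_prop) _ _),
    intervalIntegral.integral_const_mul, integral_id, intervalIntegral.integral_const]
  simp only [smul_eq_mul]
  ring

lemma pos_lin (x y a b t : ℝ) : pos x y (fun s => a + b * s) t
    = x + y * t + a * t^2 / 2 + b * t^3 / 6 := by
  unfold pos
  simp only [vel_lin]
  have : ∀ s ∈ uIcc 0 t, HasDerivAt (fun t : ℝ => y * t + a * t^2 / 2 + b * t^3 / 6)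
      (y + a * s + b * s^2 / 2) s := by
    intro s _
    have h := (((hasDerivAt_id s).const_mul y).add
      (((hasDerivAt_pow 2 s).const_mul a).div_const 2)).add
      (((hasDerivAt_pow 3 s).const_mul b).div_const 6)
    refine (h.congr_deriv ?_).congr_of_eventuallyEq ?_
    · norm_num; ring
    · exact Eventually.of_forall (fun r => by simp)
  rw [intervalIntegral.integral_eq_sub_of_hasDerivAt this
    (Continuous.intervalIntegrable (by fun_prop) _ _)]
  ring

lemma costs_nonempty (x y : ℝ) : (costs x y).Nonempty := by
  set T : ℝ := 1 + 18 * |x| + 10 * |y| with hT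
  have hT1 : 1 ≤ T := by have := abs_nonneg x; have := abs_nonneg y; linarith
  have hT0 : 0 < T := by linarith
  set a : ℝ := -6 * x / T^2 - 4 * y / T with ha
  set b : ℝ := 12 * x / T^3 + 6 * y / T^2 with hb
  let u : ℝ → ℝ := fun s => if 0 ≤ s ∧ s ≤ T then a + b * s else 0
  have e : ∀ s, 0 < s → s < T → u s = (fun s => a + b * s) s := fun s h1 h2 => by
    simp [u, h1.le, h2.le]
  have hxT : |x / T^2| ≤ |x| / T := by
    rw [abs_div, abs_of_pos (by positivity : 0 < T^2)]
    apply div_le_div_of_nonneg_left (abs_nonneg x) hT0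
    nlinarith
  have hyT : |y / T| = |y| / T := by rw [abs_div, abs_of_pos hT0]
  have hsum : 18 * (|x| / T) + 10 * (|y| / T) ≤ 1 := by
    rw [← mul_div_assoc, ← mul_div_assoc, ← add_div, div_le_one hT0]; linarith
  have hu : Ctrl u := by
    refine ⟨?_, fun s => ?_⟩
    · exact Measurable.ite measurableSet_Icc (by fun_prop) measurable_const
    · simp only [u]
      split_ifs with hs
      · have hr : a + b * s = -6 * (x / T^2) - 4 * (y / T) + 12 * ((x / T^2) * (s / T))
          + 6 * ((y / T) * (s / T)) := by
          rw [ha, hb]; field_simp; ring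
        have hs0 : 0 ≤ s / T := div_nonneg hs.1 hT0.le
        have hs1 : s / T ≤ 1 := (div_le_one hT0).2 hs.2
        have b1 : |(x / T^2) * (s / T)| ≤ |x / T^2| := by
          rw [abs_mul, abs_of_nonneg hs0]; exact mul_le_of_le_one_right (abs_nonneg _) hs1
        have b2 : |(y / T) * (s / T)| ≤ |y / T| := by
          rw [abs_mul, abs_of_nonneg hs0]; exact mul_le_of_le_one_right (abs_nonneg _) hs1
        rw [hr]
        rw [← hyT] at hsum
        rw [abs_le] at b1 b2 ⊢
        have c1 := neg_abs_le (x / T^2)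
        have c2 := neg_abs_le (y / T)
        have c3 := le_abs_self (x / T^2)
        have c4 := le_abs_self (y / T)
        constructor <;> linarith [b1.1, b1.2, b2.1, b2.2]
      · simp
  refine ⟨_, u, T, ⟨hu, hT0.le, ?_, ?_⟩, rfl⟩
  · rw [pos_congr e x y hT0.le le_rfl, pos_lin, ha, hb]; field_simp; ring
  · rw [vel_congr e y hT0.le le_rfl, vel_lin, ha, hb]; field_simp; ring

lemma val_nonneg (x y : ℝ) : 0 ≤ val x y :=
  le_csInf (costs_nonempty x y) (by rintro c ⟨u, T, h, rfl⟩; exact cost_nonneg h.2.1)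

lemma exists_near (x y : ℝ) {ε : ℝ} (hε : 0 < ε) :
    ∃ u T, Adm x y u T ∧ cost x y u T < val x y + ε := by
  obtain ⟨c, ⟨u, T, h, rfl⟩, hc⟩ := exists_lt_of_csInf_lt (costs_nonempty x y)
    (lt_add_of_pos_right (sInf (costs x y)) hε)
  exact ⟨u, T, h, hc⟩

lemma zero_adm {T : ℝ} (hT : 0 ≤ T) : Adm 0 0 (fun _ => 0) T ∧ cost 0 0 (fun _ => 0) T = 0 := by
  refine ⟨⟨Ctrl.zero, hT, ?_, ?_⟩, ?_⟩ <;> simp [cost, pos, vel]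

lemma val_zero : val 0 0 = 0 := by
  refine le_antisymm ?_ (val_nonneg 0 0)
  have := zero_adm le_rfl
  exact (val_le this.1).trans this.2.le

/-- extend by staying at zero -/
lemma extend {x y : ℝ} {u : ℝ → ℝ} {T T' : ℝ} (h : Adm x y u T) (hT : T ≤ T') :
    ∃ u', Adm x y u' T' ∧ cost x y u' T' = cost x y u T := by
  obtain ⟨hu, h0, hp, hv⟩ := h
  have z := zero_adm (sub_nonneg.2 hT)
  have k := cat_adm (x := x) (y := y) (u := u) (u' := fun _ => 0) (h := T) (T := T' - T) hu h0
    (by rw [hp, hv]; exact z.1)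
  rw [hp, hv, z.2, add_zero, add_sub_cancel] at k
  exact ⟨_, k⟩

lemma vel_comb {u u' : ℝ → ℝ} (hu : Ctrl u) (hu' : Ctrl u') (y y' a b t : ℝ) :
    vel (a * y + b * y') (fun s => a * u s + b * u' s) t = a * vel y u t + b * vel y' u' t := by
  unfold vel
  rw [intervalIntegral.integral_add ((hu.ii 0 t).const_mul a) ((hu'.ii 0 t).const_mul b),
    intervalIntegral.integral_const_mul, intervalIntegral.integral_const_mul]
  ring

lemma pos_comb {u u' : ℝ → ℝ} (hu : Ctrl u) (hu' : Ctrl u') (x x' y y' a b t : ℝ) :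
    pos (a * x + b * x') (a * y + b * y') (fun s => a * u s + b * u' s) t
      = a * pos x y u t + b * pos x' y' u' t := by
  unfold pos
  simp only [vel_comb hu hu']
  rw [intervalIntegral.integral_add
    (((hu.vel_cont y).intervalIntegrable 0 t).const_mul a)
    (((hu'.vel_cont y').intervalIntegrable 0 t).const_mul b),
    intervalIntegral.integral_const_mul, intervalIntegral.integral_const_mul]
  ring

lemma cost_comb {u u' : ℝ → ℝ} (hu : Ctrl u) (hu' : Ctrl u') (x x' y y' a b t : ℝ) (ht : 0 ≤ t)
    (ha : 0 ≤ a) (hb : 0 ≤ b) (hab : a + b = 1) :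
    cost (a * x + b * x') (a * y + b * y') (fun s => a * u s + b * u' s) t
      ≤ a * cost x y u t + b * cost x' y' u' t := by
  unfold cost
  simp only [pos_comb hu hu']
  have c1 := hu.pos_cont x y
  have c2 := hu'.pos_cont x' y'
  rw [← intervalIntegral.integral_const_mul, ← intervalIntegral.integral_const_mul,
    ← intervalIntegral.integral_add (Continuous.intervalIntegrable (by fun_prop) _ _)
      (Continuous.intervalIntegrable (by fun_prop) _ _)]
  refine intervalIntegral.integral_mono_on ht (Continuous.intervalIntegrable (by fun_prop) _ _)
      (Continuous.intervalIntegrable (by fun_prop) _ _) (fun s _ => ?_)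
  obtain rfl : b = 1 - a := by linarith
  nlinarith [mul_nonneg (mul_nonneg ha hb) (sq_nonneg (pos x y u s - pos x' y' u' s))]

lemma val_convex (x x' y y' a b : ℝ) (ha : 0 ≤ a) (hb : 0 ≤ b) (hab : a + b = 1) :
    val (a * x + b * x') (a * y + b * y') ≤ a * val x y + b * val x' y' := by
  refine le_of_forall_pos_le_add (fun ε hε => ?_)
  obtain ⟨u, T, h, hc⟩ := exists_near x y hε
  obtain ⟨u', T', h', hc'⟩ := exists_near x' y' hε
  obtain ⟨w, k, e⟩ := extend h (le_max_left T T')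
  obtain ⟨w', k', e'⟩ := extend h' (le_max_right T T')
  have hw : Ctrl (fun s => a * w s + b * w' s) := by
    refine ⟨(k.1.1.const_mul a).add (k'.1.1.const_mul b), fun s => ?_⟩
    have := k.1.2 s
    have := k'.1.2 s
    calc |a * w s + b * w' s| ≤ |a * w s| + |b * w' s| := abs_add_le _ _
      _ = a * |w s| + b * |w' s| := by rw [abs_mul, abs_mul, abs_of_nonneg ha, abs_of_nonneg hb]
      _ ≤ a * 1 + b * 1 := by gcongr
      _ = 1 := by linarith
  have hA : Adm (a * x + b * x') (a * y + b * y') (fun s => a * w s + b * w' s) (max T T') := by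
    refine ⟨hw, k.2.1, ?_, ?_⟩
    · rw [pos_comb k.1 k'.1, k.2.2.1, k'.2.2.1]; simp
    · rw [vel_comb k.1 k'.1, k.2.2.2, k'.2.2.2]; simp
  have h1 := val_le hA
  have h2 := cost_comb k.1 k'.1 x x' y y' a b (max T T') k.2.1 ha hb hab
  rw [e, e'] at h2
  have : a * cost x y u T ≤ a * (val x y + ε) := by gcongr
  have : b * cost x' y' u' T' ≤ b * (val x' y' + ε) := by gcongr
  have : a * ε + b * ε = ε := by rw [← add_mul, hab, one_mul]
  linarith

/-- easy dynamic programming inequality, backward with a constant control -/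
lemma dpp_back (x y a h : ℝ) (ha : |a| ≤ 1) (hh : 0 ≤ h) :
    val (x - h * y + a * h^2 / 2) (y - a * h) ≤ val x y + h * (|x| + h * |y| + h^2 / 2)^2 := by
  refine le_of_forall_pos_le_add (fun ε hε => ?_)
  obtain ⟨u, T, hA, hc⟩ := exists_near x y hε
  have hC : Ctrl (fun s => a + 0 * s) := ⟨by fun_prop, fun s => by simpa using ha⟩
  have hv : vel (y - a * h) (fun s => a + 0 * s) h = y := by rw [vel_lin]; ring
  have hp : pos (x - h * y + a * h^2 / 2) (y - a * h) (fun s => a + 0 * s) h = x := by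
    rw [pos_lin]; ring
  have k := cat_adm hC hh (by rw [hp, hv]; exact hA)
  rw [hp, hv] at k
  have h1 := val_le k.1
  rw [k.2] at h1
  have h2 : cost (x - h * y + a * h^2 / 2) (y - a * h) (fun s => a + 0 * s) h
      ≤ ∫ s in (0:ℝ)..h, (|x| + h * |y| + h^2 / 2)^2 := by
    unfold cost
    refine intervalIntegral.integral_mono_on hh
      (((hC.pos_cont _ _).pow 2).intervalIntegrable _ _) (by simp) (fun s hs => ?_)
    have hr : pos (x - h * y + a * h^2 / 2) (y - a * h) (fun s => a + 0 * s) s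
        = x - (h - s) * y + a * (h - s)^2 / 2 := by rw [pos_lin]; ring
    rw [hr, ← sq_abs]
    have hs0 : 0 ≤ h - s := by linarith [hs.2]
    have hs1 : h - s ≤ h := by linarith [hs.1]
    have e1 : |(h - s) * y| ≤ h * |y| := by
      rw [abs_mul, abs_of_nonneg hs0]; gcongr
    have e2 : |a * (h - s)^2 / 2| ≤ h^2 / 2 := by
      rw [abs_div, abs_mul, abs_of_nonneg (sq_nonneg (h - s)), abs_of_pos (zero_lt_two (α := ℝ))]
      have : |a| * (h - s)^2 ≤ 1 * h^2 := by gcongr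
      linarith
    have e3 : |x - (h - s) * y + a * (h - s)^2 / 2| ≤ |x| + h * |y| + h^2 / 2 := by
      calc _ ≤ |x - (h - s) * y| + |a * (h - s)^2 / 2| := abs_add_le _ _
        _ ≤ |x| + |(h - s) * y| + |a * (h - s)^2 / 2| := by gcongr; exact abs_sub _ _
        _ ≤ _ := by gcongr
    exact pow_le_pow_left₀ (abs_nonneg _) e3 2
  rw [intervalIntegral.integral_const, sub_zero, smul_eq_mul] at h2
  linarith

lemma vel_bd {u : ℝ → ℝ} (hu : Ctrl u) (y t : ℝ) (ht : 0 ≤ t) : |vel y u t - y| ≤ t := by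
  have := intervalIntegral.norm_integral_le_of_norm_le_const (f := u) (C := 1) (a := 0) (b := t)
    (fun s _ => by simpa using hu.2 s)
  simpa [vel, abs_of_nonneg ht] using this

lemma pos_bd {u : ℝ → ℝ} (hu : Ctrl u) (x y t : ℝ) (ht : 0 ≤ t) :
    |pos x y u t - x - t * y| ≤ t^2 := by
  have e : pos x y u t - x - t * y = ∫ s in (0:ℝ)..t, (vel y u s - y) := by
    rw [intervalIntegral.integral_sub ((hu.vel_cont y).intervalIntegrable _ _) (by simp)]
    simp [pos]
  have := intervalIntegral.norm_integral_le_of_norm_le_const (f := fun s => vel y u s - y)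
    (C := t) (a := 0) (b := t) (fun s hs => by
      rw [uIoc_of_le ht] at hs
      exact (vel_bd hu y s hs.1.le).trans hs.2)
  rw [e]
  simpa [abs_of_nonneg ht, sq] using this

lemma cost_lower {u : ℝ → ℝ} (hu : Ctrl u) (x y h : ℝ) (hh : 0 ≤ h) (h1 : h ≤ 1) :
    h * (x^2 - 2 * |x| * (h * (|y| + 1))) ≤ cost x y u h := by
  have : ∫ s in (0:ℝ)..h, (x^2 - 2 * |x| * (h * (|y| + 1))) ≤ cost x y u h := by
    unfold cost
    refine intervalIntegral.integral_mono_on hh (by simp)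
      (((hu.pos_cont _ _).pow 2).intervalIntegrable _ _)  (fun s hs => ?_)
    have b := pos_bd hu x y s hs.1
    set p := pos x y u s
    have b2 : |p - x| ≤ h * (|y| + 1) := by
      calc |p - x| = |(p - x - s * y) + s * y| := by ring_nf
        _ ≤ |p - x - s * y| + |s * y| := abs_add_le _ _
        _ ≤ s^2 + s * |y| := by rw [abs_mul, abs_of_nonneg hs.1]; gcongr
        _ ≤ h * 1 + h * |y| := by
          have : s^2 ≤ h * 1 := by nlinarith [hs.1, hs.2]
          have := mul_le_mul_of_nonneg_right hs.2 (abs_nonneg y)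
          linarith
        _ = _ := by ring
    have b3 : |x * (p - x)| ≤ |x| * (h * (|y| + 1)) := by
      rw [abs_mul]; gcongr
    have := neg_abs_le (x * (p - x))
    nlinarith [sq_nonneg (p - x)]
  rwa [intervalIntegral.integral_const, sub_zero, smul_eq_mul] at this

/-- hard dynamic programming inequality -/
lemma dpp_fwd (x y : ℝ) (hxy : ¬ (x = 0 ∧ y = 0)) : ∀ᶠ h in 𝓝[>] (0:ℝ), ∃ X V : ℝ,
    |V - y| ≤ h ∧ |X - x - h * y| ≤ h^2 ∧
    h * (x^2 - 2 * |x| * (h * (|y| + 1))) + val X V ≤ val x y + h^2 := by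
  have hT : ∀ᶠ h in 𝓝[>] (0:ℝ), ∀ u T, Adm x y u T → h ≤ T := by
    by_cases hy : y = 0
    · have hx : 0 < |x| := abs_pos.2 (fun hx => hxy ⟨hx, hy⟩)
      have : ∀ᶠ h in 𝓝 (0:ℝ), h^2 < |x| := by
        have c : Continuous fun h : ℝ => h^2 := by fun_prop
        exact c.continuousAt.eventually_lt continuousAt_const (by simpa using hx)
      filter_upwards [this.filter_mono nhdsWithin_le_nhds] with h hh u T hA
      by_contra hlt
      have b := pos_bd hA.1 x y T hA.2.1
      rw [hA.2.2.1, hy, mul_zero, sub_zero, zero_sub, abs_neg] at b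
      nlinarith [hA.2.1]
    · have : ∀ᶠ h in 𝓝 (0:ℝ), h < |y| := eventually_lt_nhds (abs_pos.2 hy)
      filter_upwards [this.filter_mono nhdsWithin_le_nhds] with h hh u T hA
      by_contra hlt
      have b := vel_bd hA.1 y T hA.2.1
      rw [hA.2.2.2, zero_sub, abs_neg] at b
      linarith
  have h1 : ∀ᶠ h in 𝓝[>] (0:ℝ), h ≤ 1 :=
    ((eventually_lt_nhds one_pos).filter_mono nhdsWithin_le_nhds).mono (fun _ h => le_of_lt h)
  filter_upwards [hT, h1, self_mem_nhdsWithin] with h hT h1 h0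
  have h0 : 0 < h := h0
  obtain ⟨u, T, hA, hc⟩ := exists_near x y (by positivity : 0 < h^2)
  have hle := hT u T hA
  refine ⟨pos x y u h, vel y u h, vel_bd hA.1 y h h0.le, pos_bd hA.1 x y h h0.le, ?_⟩
  have s1 := pos_shift hA.1 x y h (T - h)
  have s2 := vel_shift hA.1 y h (T - h)
  have s3 := cost_shift hA.1 x y h (T - h)
  rw [add_sub_cancel] at s1 s2 s3
  have hB : Adm (pos x y u h) (vel y u h) (fun s => u (h + s)) (T - h) :=
    ⟨hA.1.shift h, sub_nonneg.2 hle, by rw [← s1]; exact hA.2.2.1, by rw [← s2]; exact hA.2.2.2⟩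
  have := val_le hB
  have := cost_lower hA.1 x y h h0.le h1
  linarith

end Fuller

namespace Fuller

/-- mean of a relaxed control -/
def mean (β : ℝ → Measure (Icc (-1:ℝ) 1)) (s : ℝ) : ℝ := ∫ a, (a : ℝ) ∂(β s)

lemma integrable_coe (m : Measure (Icc (-1:ℝ) 1)) [IsProbabilityMeasure m] :
    Integrable (fun a : Icc (-1:ℝ) 1 => (a : ℝ)) m := by
  refine Integrable.of_bound (C := 1) measurable_subtype_coe.aestronglyMeasurable
    (ae_of_all _ fun a => ?_)
  exact abs_le.2 a.2

lemma mean_ctrl {β : ℝ → Measure (Icc (-1:ℝ) 1)} (h : IsRelaxedControl β) : Ctrl (mean β) := by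
  refine ⟨h.2 ⟨fun a => (a : ℝ), continuous_subtype_val⟩, fun s => ?_⟩
  have := h.1 s
  have := norm_integral_le_of_norm_le_const (μ := β s) (f := fun a : Icc (-1:ℝ) 1 => (a : ℝ))
    (C := 1) (ae_of_all _ fun a => abs_le.2 a.2)
  simpa [mean] using this

lemma inner_int (m : Measure (Icc (-1:ℝ) 1)) [IsProbabilityMeasure m] (c : ℝ) :
    ∫ a, ((WithLp.equiv 2 (Fin 2 → ℝ)).symm ![c, (a : ℝ)] : EuclideanSpace ℝ (Fin 2)) ∂m
      = c • EuclideanSpace.single 0 (1:ℝ) + (∫ a, (a : ℝ) ∂m) • EuclideanSpace.single 1 (1:ℝ) := by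
  have e : ∀ a : Icc (-1:ℝ) 1,
      ((WithLp.equiv 2 (Fin 2 → ℝ)).symm ![c, (a : ℝ)] : EuclideanSpace ℝ (Fin 2))
      = c • EuclideanSpace.single 0 (1:ℝ) + (a : ℝ) • EuclideanSpace.single 1 (1:ℝ) := by
    intro a
    ext i
    fin_cases i <;> simp
  simp_rw [e]
  rw [integral_add (integrable_const _) ((integrable_coe m).smul_const _)]
  congr 1
  · simp
  · exact integral_smul_const (fun a : Icc (-1:ℝ) 1 => (a : ℝ)) _

lemma traj {β : ℝ → Measure (Icc (-1:ℝ) 1)} (hβ : IsRelaxedControl β)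
    {z : EuclideanSpace ℝ (Fin 2)} {y : ℝ → EuclideanSpace ℝ (Fin 2)}
    (h : IsTrajectory (fun z (a : Icc (-1:ℝ) 1) =>
        (WithLp.equiv 2 (Fin 2 → ℝ)).symm ![z 1, (a : ℝ)]) β z y) :
    ∀ t, 0 ≤ t → y t 0 = pos (z 0) (z 1) (mean β) t ∧ y t 1 = vel (z 1) (mean β) t := by
  obtain ⟨h0, hc, hi⟩ := h
  have hm := mean_ctrl hβ
  have hc1 : Continuous fun s => y s 1 := by fun_prop
  have key : ∀ t, 0 ≤ t → y t = z + ((∫ s in (0:ℝ)..t, y s 1) • EuclideanSpace.single 0 (1:ℝ)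
      + (∫ s in (0:ℝ)..t, mean β s) • EuclideanSpace.single 1 (1:ℝ)) := by
    intro t ht
    rw [hi t ht]
    congr 1
    have e : ∀ s, ∫ a, ((WithLp.equiv 2 (Fin 2 → ℝ)).symm ![y s 1, (a : ℝ)] :
        EuclideanSpace ℝ (Fin 2)) ∂(β s) = y s 1 • EuclideanSpace.single 0 (1:ℝ)
        + mean β s • EuclideanSpace.single 1 (1:ℝ) := fun s => by
      have := hβ.1 s
      exact inner_int _ _
    simp_rw [e]
    rw [intervalIntegral.integral_add, intervalIntegral.integral_smul_const,
      intervalIntegral.integral_smul_const]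
    · exact Continuous.intervalIntegrable (by fun_prop) _ _
    · have := hm.ii 0 t
      rw [intervalIntegrable_iff] at this ⊢
      exact this.smul_const _
  have k1 : ∀ t, 0 ≤ t → y t 1 = vel (z 1) (mean β) t := fun t ht => by
    rw [key t ht]; simp [vel]
  refine fun t ht => ⟨?_, k1 t ht⟩
  have : y t 0 = z 0 + ∫ s in (0:ℝ)..t, y s 1 := by
    have := congrArg (fun q : EuclideanSpace ℝ (Fin 2) => q 0) (key t ht)
    simpa using this
  rw [this, pos, ii_congr ht (fun s hs _ => k1 s hs.le)]

lemma run {β : ℝ → Measure (Icc (-1:ℝ) 1)} (hβ : IsRelaxedControl β)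
    {z : EuclideanSpace ℝ (Fin 2)} {y : ℝ → EuclideanSpace ℝ (Fin 2)}
    (h : IsTrajectory (fun z (a : Icc (-1:ℝ) 1) =>
        (WithLp.equiv 2 (Fin 2 → ℝ)).symm ![z 1, (a : ℝ)]) β z y) (t : ℝ) (ht : 0 ≤ t) :
    runCost (fun z (_ : Icc (-1:ℝ) 1) => (z 0)^2) β y t
      = ENNReal.ofReal (cost (z 0) (z 1) (mean β) t) := by
  have hm := mean_ctrl hβ
  unfold runCost cost
  rw [intervalIntegral.integral_of_le ht, ofReal_integral_eq_lintegral_ofReal]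
  · refine setLIntegral_congr_fun measurableSet_Ioc (fun s hs => ?_)
    have := hβ.1 s
    simp [(traj hβ h s hs.1.le).1]
  · exact (((hm.pos_cont _ _).pow 2).intervalIntegrable 0 t).1
  · exact ae_of_all _ fun s => sq_nonneg _

lemma mem_exit {β : ℝ → Measure (Icc (-1:ℝ) 1)} (hβ : IsRelaxedControl β)
    {z : EuclideanSpace ℝ (Fin 2)} {y : ℝ → EuclideanSpace ℝ (Fin 2)}
    (h : IsTrajectory (fun z (a : Icc (-1:ℝ) 1) =>
        (WithLp.equiv 2 (Fin 2 → ℝ)).symm ![z 1, (a : ℝ)]) β z y) (t : ℝ) :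
    t ∈ exitTimes {(0 : EuclideanSpace ℝ (Fin 2))} y ↔ Adm (z 0) (z 1) (mean β) t := by
  constructor
  · rintro ⟨h0, h1⟩
    have := traj hβ h t h0
    rw [mem_singleton_iff.1 h1] at this
    exact ⟨mean_ctrl hβ, h0, by simpa using this.1.symm, by simpa using this.2.symm⟩
  · rintro ⟨-, h0, h1, h2⟩
    have := traj hβ h t h0
    rw [h1, h2] at this
    refine ⟨h0, ?_⟩
    rw [mem_singleton_iff]
    ext i
    fin_cases i
    · simpa using this.1
    · simpa using this.2

lemma exit_closed {y : ℝ → EuclideanSpace ℝ (Fin 2)} (hc : Continuous y) :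
    IsClosed (exitTimes {(0 : EuclideanSpace ℝ (Fin 2))} y) :=
  isClosed_Ici.inter (isClosed_singleton.preimage hc)

lemma exit_bdd {y : ℝ → EuclideanSpace ℝ (Fin 2)} :
    BddBelow (exitTimes {(0 : EuclideanSpace ℝ (Fin 2))} y) := ⟨0, fun _ h => h.1⟩

/-- Dirac control -/
def dir (u : ℝ → ℝ) (hu : Ctrl u) (s : ℝ) : Measure (Icc (-1:ℝ) 1) :=
  Measure.dirac ⟨u s, abs_le.1 (hu.2 s)⟩

lemma dir_rel (u : ℝ → ℝ) (hu : Ctrl u) : IsRelaxedControl (dir u hu) := by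
  refine ⟨fun t => by unfold dir; infer_instance, fun g => ?_⟩
  simp only [dir, integral_dirac]
  exact g.continuous.measurable.comp (hu.1.subtype_mk)

lemma dir_mean (u : ℝ → ℝ) (hu : Ctrl u) : mean (dir u hu) = u := by
  ext s
  simp [mean, dir]

lemma val_eq (Y : EuclideanSpace ℝ (Fin 2) → (ℝ → Measure (Icc (-1:ℝ) 1)) → ℝ →
      EuclideanSpace ℝ (Fin 2))
    (hY : ∀ z β, IsRelaxedControl β →
      IsTrajectory (fun z (a : Icc (-1:ℝ) 1) =>
        (WithLp.equiv 2 (Fin 2 → ℝ)).symm ![z 1, (a : ℝ)]) β z (Y z β))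
    (z : EuclideanSpace ℝ (Fin 2)) :
    ((val (z 0) (z 1) : ℝ) : EReal) = valueFn {(0 : EuclideanSpace ℝ (Fin 2))}
          (fun z (_ : Icc (-1:ℝ) 1) => (z 0)^2) Y z := by
  have co : ∀ r : ℝ, 0 ≤ r → ((ENNReal.ofReal r : ℝ≥0∞) : EReal) = (r : EReal) := fun r hr => by
    rw [EReal.coe_ennreal_ofReal, max_eq_left hr]
  apply le_antisymm
  · apply le_sInf
    rintro c ⟨β, hβ, hne, rfl⟩
    have hm := (exit_closed (hY z β hβ).2.1).csInf_mem hne exit_bdd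
    have hA := (mem_exit hβ (hY z β hβ) _).1 hm
    rw [run hβ (hY z β hβ) _ hA.2.1, co _ (cost_nonneg hA.2.1)]
    exact EReal.coe_le_coe_iff.2 (val_le hA)
  · refine EReal.le_of_forall_lt_iff_le.1 (fun r hr => ?_)
    have hr' : val (z 0) (z 1) < r := EReal.coe_lt_coe_iff.1 hr
    obtain ⟨u, T, hA, hc⟩ := exists_near (z 0) (z 1) (sub_pos.2 hr')
    have hβ := dir_rel u hA.1
    have ht := hY z _ hβ
    have hT : T ∈ exitTimes {(0 : EuclideanSpace ℝ (Fin 2))} (Y z (dir u hA.1)) := by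
      rw [mem_exit hβ ht, dir_mean]; exact hA
    have hm := (exit_closed ht.2.1).csInf_mem ⟨T, hT⟩ exit_bdd
    have hle := csInf_le exit_bdd hT
    refine le_trans (sInf_le ⟨dir u hA.1, hβ, ⟨T, hT⟩, rfl⟩) ?_
    rw [run hβ ht _ hm.1, co _ (cost_nonneg hm.1), dir_mean]
    refine EReal.coe_le_coe_iff.2 ((cost_mono hA.1 hle).trans ?_)
    linarith

/-- nonnegative right derivative at a right-sided local minimum -/
lemma deriv_nonneg_of_right_min {f : ℝ → ℝ} {f' : ℝ} (hf : HasDerivAt f f' 0)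
    (h : ∀ᶠ t in 𝓝[>] (0:ℝ), f 0 ≤ f t) : 0 ≤ f' := by
  have := (hasDerivWithinAt_iff_tendsto_slope' (s := Ioi (0:ℝ)) (by simp)).1
    hf.hasDerivWithinAt
  refine ge_of_tendsto this ?_
  filter_upwards [h, self_mem_nhdsWithin] with t ht h0
  have h0 : 0 < t := h0
  rw [slope_def_field]
  exact div_nonneg (by linarith) (by linarith)

lemma inner_two (p q : EuclideanSpace ℝ (Fin 2)) : inner ℝ p q = p 0 * q 0 + p 1 * q 1 := by
  simp [PiLp.inner_apply, Fin.sum_univ_two]; ring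

lemma grad_curve {γ : EuclideanSpace ℝ (Fin 2) → ℝ} {z : EuclideanSpace ℝ (Fin 2)}
    (hγ : DifferentiableAt ℝ γ z) {c : ℝ → EuclideanSpace ℝ (Fin 2)}
    {c' : EuclideanSpace ℝ (Fin 2)} (hc : HasDerivAt c c' 0) (h0 : c 0 = z) :
    HasDerivAt (fun t => γ (c t)) (gradient γ z 0 * c' 0 + gradient γ z 1 * c' 1) 0 := by
  have h1 := hγ.hasGradientAt.hasFDerivAt
  rw [← h0] at h1
  have h2 := h1.comp_hasDerivAt (0:ℝ) hc
  refine h2.congr_deriv ?_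
  rw [h0, InnerProductSpace.toDual_apply_apply, inner_two]

lemma visc_max {γ : EuclideanSpace ℝ (Fin 2) → ℝ} {z : EuclideanSpace ℝ (Fin 2)}
    (hγ : DifferentiableAt ℝ γ z)
    (h : ∀ᶠ q in 𝓝 z, -val (-(q 0)) (q 1) - γ q ≤ -val (-(z 0)) (z 1) - γ z) (a : ℝ)
    (ha : |a| ≤ 1) :
    -(z 1) * gradient γ z 0 + a * gradient γ z 1 - (z 0)^2 ≤ 0 := by
  let e0 : EuclideanSpace ℝ (Fin 2) := EuclideanSpace.single 0 (1:ℝ)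
  let e1 : EuclideanSpace ℝ (Fin 2) := EuclideanSpace.single 1 (1:ℝ)
  let c : ℝ → EuclideanSpace ℝ (Fin 2) := fun t =>
    z + (t * z 1 - a * t^2 / 2) • e0 + (-a * t) • e1
  have c0 : c 0 = z := by simp [c]
  have hc : HasDerivAt c ((z 1) • e0 + (-a) • e1) 0 := by
    have d1 : HasDerivAt (fun t : ℝ => t * z 1 - a * t^2 / 2) (z 1) 0 := by
      have := ((hasDerivAt_id (0:ℝ)).mul_const (z 1)).sub
        (((hasDerivAt_pow 2 (0:ℝ)).const_mul a).div_const 2)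
      refine this.congr_deriv ?_
      simp
    have d2 : HasDerivAt (fun t : ℝ => -a * t) (-a) 0 := by
      simpa using (hasDerivAt_id (0:ℝ)).const_mul (-a)
    exact ((d1.smul_const e0).const_add z).add (d2.smul_const e1)
  have hg := grad_curve hγ hc c0
  have hk : HasDerivAt (fun h : ℝ => h * (|z 0| + h * |z 1| + h^2 / 2)^2) ((z 0)^2) 0 := by
    have d : DifferentiableAt ℝ (fun h : ℝ => (|z 0| + h * |z 1| + h^2 / 2)^2) 0 := by fun_prop
    have := (hasDerivAt_id (0:ℝ)).mul d.hasDerivAt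
    refine this.congr_deriv ?_
    simp
  have hs := hg.add hk
  have := deriv_nonneg_of_right_min hs (by
    have ht : Tendsto c (𝓝[>] 0) (𝓝 z) := by
      have := hc.continuousAt.tendsto
      rw [c0] at this
      exact this.mono_left nhdsWithin_le_nhds
    filter_upwards [ht.eventually h, self_mem_nhdsWithin] with t h1 h0
    have h0 : 0 < t := h0
    have k := dpp_back (-(z 0)) (z 1) a t ha h0.le
    have f0 : -(c t 0) = -(z 0) - t * z 1 + a * t^2 / 2 := by simp [c, e0, e1]; ring
    have f3 : c t 1 = z 1 - a * t := by simp [c, e0, e1]; ring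
    rw [f0, f3] at h1
    rw [abs_neg] at k
    simp only [Pi.add_apply, c0]
    linarith)
  simp [e0, e1] at this
  linarith

lemma visc_min {γ : EuclideanSpace ℝ (Fin 2) → ℝ} {z : EuclideanSpace ℝ (Fin 2)} (hz : z ≠ 0)
    (hγ : DifferentiableAt ℝ γ z)
    (h : ∀ᶠ q in 𝓝 z, -val (-(z 0)) (z 1) - γ z ≤ -val (-(q 0)) (q 1) - γ q) :
    0 ≤ -(z 1) * gradient γ z 0 + |gradient γ z 1| - (z 0)^2 := by
  let e0 : EuclideanSpace ℝ (Fin 2) := EuclideanSpace.single 0 (1:ℝ)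
  let e1 : EuclideanSpace ℝ (Fin 2) := EuclideanSpace.single 1 (1:ℝ)
  set g0 := gradient γ z 0 with hg0
  set g1 := gradient γ z 1 with hg1
  -- global affine lower bound
  have aff : ∀ d0 d1 : ℝ, val (-(z 0)) (z 1) - (g0 * d0 + g1 * d1) ≤ val (-(z 0) - d0) (z 1 + d1) := by
    intro d0 d1
    let c : ℝ → EuclideanSpace ℝ (Fin 2) := fun t => z + t • ((-d0) • e0 + (-d1) • e1)
    have c0 : c 0 = z := by simp [c]
    have hc : HasDerivAt c ((-d0) • e0 + (-d1) • e1) 0 := by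
      have := ((hasDerivAt_id (0:ℝ)).smul_const ((-d0) • e0 + (-d1) • e1)).const_add z
      rw [one_smul] at this
      exact this
    have hg := grad_curve hγ hc c0
    have hl : HasDerivAt (fun t : ℝ => t * (val (-(z 0) - d0) (z 1 + d1) - val (-(z 0)) (z 1)))
        (val (-(z 0) - d0) (z 1 + d1) - val (-(z 0)) (z 1)) 0 := by
      simpa using (hasDerivAt_id (0:ℝ)).mul_const
        (val (-(z 0) - d0) (z 1 + d1) - val (-(z 0)) (z 1))
    have := deriv_nonneg_of_right_min (hl.sub hg) (by
      have ht : Tendsto c (𝓝[>] 0) (𝓝 z) := by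
        have := hc.continuousAt.tendsto
        rw [c0] at this
        exact this.mono_left nhdsWithin_le_nhds
      filter_upwards [ht.eventually h, self_mem_nhdsWithin] with t h1 h0
      have h0 : 0 < t := h0
      have f0 : -(c t 0) = -(z 0) + t * d0 := by simp [c, e0, e1]; ring
      have f3 : c t 1 = z 1 - t * d1 := by simp [c, e0, e1]; ring
      rw [f0, f3] at h1
      have k := val_convex (-(z 0) + t * d0) (-(z 0) - d0) (z 1 - t * d1) (z 1 + d1)
        (1 / (1 + t)) (t / (1 + t)) (by positivity) (by positivity) (by field_simp)
      have f1 : 1 / (1 + t) * (-(z 0) + t * d0) + t / (1 + t) * (-(z 0) - d0) = -(z 0) := by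
        field_simp; ring
      have f2 : 1 / (1 + t) * (z 1 - t * d1) + t / (1 + t) * (z 1 + d1) = z 1 := by
        field_simp; ring
      rw [f1, f2] at k
      have k2 : (1 + t) * val (-(z 0)) (z 1) ≤ val (-(z 0) + t * d0) (z 1 - t * d1)
          + t * val (-(z 0) - d0) (z 1 + d1) := by
        calc _ ≤ (1 + t) * _ := mul_le_mul_of_nonneg_left k (by positivity)
          _ = _ := by field_simp
      simp only [Pi.sub_apply, c0]
      linarith)
    simp [e0, e1] at this
    linarith
  have hxy : ¬ (-(z 0) = 0 ∧ z 1 = 0) := by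
    rintro ⟨h1, h2⟩
    apply hz
    ext i
    fin_cases i
    · simpa using h1
    · simpa using h2
  have ev := dpp_fwd (-(z 0)) (z 1) hxy
  -- in the limit
  have lim : Tendsto (fun h : ℝ => h + |g0| * h + 2 * |z 0| * (h * (|z 1| + 1))) (𝓝[>] 0)
      (𝓝 0) := by
    have : Continuous (fun h : ℝ => h + |g0| * h + 2 * |z 0| * (h * (|z 1| + 1))) := by fun_prop
    have := this.tendsto 0
    simp only [mul_zero, zero_mul, add_zero] at this
    exact this.mono_left nhdsWithin_le_nhds
  have : (z 0)^2 + g0 * z 1 - |g1| ≤ 0 := by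
    refine ge_of_tendsto lim ?_
    filter_upwards [ev, self_mem_nhdsWithin] with t ⟨X, V, hV, hX, hd⟩ h0
    have h0 : 0 < t := h0
    have k := aff (-(z 0) - X) (V - z 1)
    rw [sub_sub_cancel, add_sub_cancel] at k
    rw [abs_neg, neg_sq] at hd
    have m1 : |g1 * (V - z 1)| ≤ |g1| * t := by rw [abs_mul]; gcongr
    have m0 : |g0 * (X - -(z 0) - t * z 1)| ≤ |g0| * t^2 := by rw [abs_mul]; gcongr
    have m1' := (abs_le.1 m1).2
    have m0' := (abs_le.1 m0).1
    have : t * ((z 0)^2 + g0 * z 1 - |g1|) ≤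
        t * (t + |g0| * t + 2 * |z 0| * (t * (|z 1| + 1))) := by nlinarith
    exact le_of_mul_le_mul_left this h0
  linarith

end Fuller

/-- the Fuller Problem.  With control set `A = [−1,1]`, target
`T = {(0,0)}`, dynamics `f(x,y,a) = (y,a)` and Lagrangian `ℓ(x,y,a) = x²`, the value
function `v₀` is finite and convex (hence continuous), and `w(x,y) := −v₀(−x,y)` is a
viscosity solution of `−y(Dw)₁ + |(Dw)₂| − x² = 0` on `ℝ² ∖ {(0,0)}` vanishing at the
origin (so boundedness from below cannot be dropped in the uniqueness theorem). -/
theorem fuller_value_convex_and_second_solution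
    -- the trajectory map for the Fuller dynamics `f(x,y,a) = (y,a)`
    (Y : EuclideanSpace ℝ (Fin 2) → (ℝ → Measure (Icc (-1:ℝ) 1)) → ℝ →
      EuclideanSpace ℝ (Fin 2))
    (hY : ∀ z β, IsRelaxedControl β →
      IsTrajectory (fun z (a : Icc (-1:ℝ) 1) =>
        (WithLp.equiv 2 (Fin 2 → ℝ)).symm ![z 1, (a : ℝ)]) β z (Y z β)) :
    ∃ v₀ : EuclideanSpace ℝ (Fin 2) → ℝ,
      -- `v₀` is (the real representative of) the Fuller value function: in particular
      -- the value function is finite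
      (∀ z, (v₀ z : EReal) =
        valueFn {(0 : EuclideanSpace ℝ (Fin 2))}
          (fun z (_ : Icc (-1:ℝ) 1) => (z 0)^2) Y z) ∧
      -- (1) `v₀` is convex on `ℝ²`
      ConvexOn ℝ univ v₀ ∧
      -- (2) `w(x,y) = −v₀(−x,y)` is a viscosity solution of the Fuller HJBE on
      -- `ℝ² ∖ {(0,0)}` that vanishes at the origin
      IsViscositySol (fun z p => -(z 1) * p 0 + |p 1| - (z 0)^2)
        ({(0 : EuclideanSpace ℝ (Fin 2))}ᶜ)
        (fun z => -v₀ ((WithLp.equiv 2 (Fin 2 → ℝ)).symm ![-(z 0), z 1])) ∧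
      -v₀ ((WithLp.equiv 2 (Fin 2 → ℝ)).symm ![-(0:ℝ), 0]) = 0 := by
  have hG : IsOpen ({(0 : EuclideanSpace ℝ (Fin 2))}ᶜ) := isOpen_compl_singleton
  refine ⟨fun z => Fuller.val (z 0) (z 1), Fuller.val_eq Y hY, ⟨convex_univ, ?_⟩, ⟨?_, ?_⟩, ?_⟩
  · intro p _ q _ a b ha hb hab
    simpa using Fuller.val_convex (p 0) (q 0) (p 1) (q 1) a b ha hb hab
  · intro γ hγ z hz h
    have hd : DifferentiableAt ℝ γ z :=
      (hγ.differentiableOn (by norm_num)).differentiableAt (hG.mem_nhds hz)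
    have h' := (h.isLocalMin (hG.mem_nhds hz))
    exact Fuller.visc_min hz hd (by simpa [IsLocalMin, IsMinFilter] using h')
  · intro γ hγ z hz h
    have hd : DifferentiableAt ℝ γ z :=
      (hγ.differentiableOn (by norm_num)).differentiableAt (hG.mem_nhds hz)
    have h' := (h.isLocalMax (hG.mem_nhds hz))
    have h'' : ∀ᶠ q in 𝓝 z, -Fuller.val (-(q 0)) (q 1) - γ q
        ≤ -Fuller.val (-(z 0)) (z 1) - γ z := by
      simpa [IsLocalMax, IsMaxFilter] using h'
    have k1 := Fuller.visc_max hd h'' 1 (by simp)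
    have k2 := Fuller.visc_max hd h'' (-1) (by simp)
    show -(z 1) * gradient γ z 0 + |gradient γ z 1| - (z 0)^2 ≤ 0
    rcases abs_cases (gradient γ z 1) with ⟨e, -⟩ | ⟨e, -⟩ <;> rw [e] <;> linarith
  · simp [Fuller.val_zero]
end
end

section
/- Define Ĩ : ℝ² → [3/4, 1) by Ĩ(p) := 3e^{2‖p‖}/(1 + 3e^{2‖p‖}), let β(t) := (0, −1/(t+1)) for t ≥ 0, and let x : [0,∞) → ℝ², x(t) = (x₁(t), x₂(t)), be the unique solution of ẋ(t) = −Ĩ(x(t))β(t), x(0) = (0,1). Then x₁(t) = 0 and x₂(t) ≥ 1 + (3/4)ln(t+1) for all t ≥ 0 (so the trajectory x(·) is unbounded), yet the total running cost ∫₀^∞ [1 − Ĩ(x(s))(1 − ‖β(s)‖²)^{1/2}] ds is finite. In particular, the exit-time problem with dynamics f̃(p,u) = −Ĩ(p)u, control set the closed unit ball of ℝ², and Lagrangian ℓ̃(p,u) = 1 − Ĩ(p)(1 − ‖u‖²)^{1/2} violates the affordability hypothesis (H6). -/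
open Set Filter Topology MeasureTheory
open scoped ENNReal

noncomputable section

/-- The light intensity `Ĩ(p) = 3e^{2‖p‖}/(1 + 3e^{2‖p‖}) ∈ [3/4, 1)`. -/
def Itilde (p : EuclideanSpace ℝ (Fin 2)) : ℝ :=
  3 * Real.exp (2 * ‖p‖) / (1 + 3 * Real.exp (2 * ‖p‖))

/-- The control `β(t) = (0, −1/(t+1))`. -/
def ctrl (t : ℝ) : EuclideanSpace ℝ (Fin 2) :=
  (WithLp.equiv 2 (Fin 2 → ℝ)).symm ![0, -1/(t+1)]

/-- failure of `(H₆)` for the intensity `Ĩ`.  Along the solution of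
`ẋ = −Ĩ(x)β(t)`, `x(0) = (0,1)`, one has `x₁ ≡ 0` and `x₂(t) ≥ 1 + (3/4)ln(t+1)` (so the
trajectory is unbounded), yet the total running cost
`∫₀^∞ [1 − Ĩ(x(s))(1−‖β(s)‖²)^{1/2}] ds` is finite; hence the shape-from-shading
problem with dynamics `f̃(p,u) = −Ĩ(p)u` and Lagrangian
`ℓ̃(p,u) = 1 − Ĩ(p)(1−‖u‖²)^{1/2}` violates `(H₆)`. -/
theorem H6_fails_for_exponential_intensity
    (x : ℝ → EuclideanSpace ℝ (Fin 2))
    (hx0 : x 0 = (WithLp.equiv 2 (Fin 2 → ℝ)).symm ![0, 1])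
    (hode : ∀ t ∈ Ici (0:ℝ),
      HasDerivWithinAt x (-(Itilde (x t)) • ctrl t) (Ici (0:ℝ)) t) :
    (∀ t, 0 ≤ t → x t 0 = 0) ∧
    (∀ t, 0 ≤ t → 1 + 3/4 * Real.log (t+1) ≤ x t 1) ∧
    (∫⁻ s in Ioi (0:ℝ),
      ENNReal.ofReal (1 - Itilde (x s) * Real.sqrt (1 - ‖ctrl s‖^2))) < ⊤ := by
  have hc : ∀ (i : Fin 2), ∀ t ∈ Ici (0:ℝ),
      HasDerivWithinAt (fun s => x s i) ((-(Itilde (x t)) • ctrl t) i) (Ici (0:ℝ)) t := by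
    intro i t ht
    exact (EuclideanSpace.proj (𝕜 := ℝ) i).hasFDerivAt.comp_hasDerivWithinAt t (hode t ht)
  have hI : ∀ p, Itilde p = 1 - 1 / (1 + 3 * Real.exp (2 * ‖p‖)) := by
    intro p
    have := Real.exp_pos (2 * ‖p‖)
    unfold Itilde
    field_simp
    ring
  have hI34 : ∀ p, 3 / 4 ≤ Itilde p := by
    intro p
    have : 1 ≤ Real.exp (2 * ‖p‖) := Real.one_le_exp (by positivity)
    unfold Itilde
    rw [div_le_div_iff₀ (by norm_num) (by positivity)]
    linarith
  have hint : ∀ t ∈ interior (Ici (0:ℝ)), t ∈ Ici (0:ℝ) := fun t ht => interior_subset ht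
  have h0 : ∀ t, 0 ≤ t → x t 0 = 0 := by
    have hd : ∀ t ∈ interior (Ici (0:ℝ)),
        HasDerivWithinAt (fun s => x s 0) 0 (interior (Ici (0:ℝ))) t := by
      intro t ht
      have := (hc 0 t (hint t ht)).mono interior_subset
      simpa [ctrl] using this
    have hcont : ContinuousOn (fun s => x s 0) (Ici (0:ℝ)) :=
      fun t ht => (hc 0 t ht).continuousWithinAt
    have hm := monotoneOn_of_hasDerivWithinAt_nonneg (convex_Ici 0) hcont hd (fun _ _ => le_rfl)
    have ha := antitoneOn_of_hasDerivWithinAt_nonpos (convex_Ici 0) hcont hd (fun _ _ => le_rfl)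
    intro t ht
    have e : x 0 0 = 0 := by simp [hx0]
    have h1 := hm (mem_Ici.2 le_rfl) (mem_Ici.2 ht) ht
    have h2 := ha (mem_Ici.2 le_rfl) (mem_Ici.2 ht) ht
    simp only [e] at h1 h2
    exact le_antisymm h2 h1
  have h1 : ∀ t, 0 ≤ t → 1 + 3/4 * Real.log (t+1) ≤ x t 1 := by
    have hd : ∀ t ∈ Ici (0:ℝ),
        HasDerivWithinAt (fun s => x s 1 - 3/4 * Real.log (s+1))
          ((Itilde (x t) - 3/4) * (1/(t+1))) (Ici (0:ℝ)) t := by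
      intro t ht
      have ht' : (0:ℝ) ≤ t := ht
      have hl : HasDerivAt (fun s : ℝ => Real.log (s+1)) (1/(t+1)) t :=
        ((hasDerivAt_id t).add_const 1).log (by simp only [id]; linarith)
      have := (hc 1 t ht).sub ((hl.const_mul (3/4)).hasDerivWithinAt)
      refine HasDerivWithinAt.congr_deriv this ?_
      simp [ctrl]
      ring
    have hm := monotoneOn_of_hasDerivWithinAt_nonneg (convex_Ici 0)
      (fun t ht => (hd t ht).continuousWithinAt)
      (fun t ht => (hd t (hint t ht)).mono interior_subset)
      (fun t ht => mul_nonneg (by linarith [hI34 (x t)])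
        (by have : (0:ℝ) ≤ t := hint t ht
            positivity))
    intro t ht
    have e : x 0 1 = 1 := by simp [hx0]
    have h1 := hm (mem_Ici.2 le_rfl) (mem_Ici.2 ht) ht
    simp only [e] at h1
    norm_num at h1
    linarith
  refine ⟨h0, h1, ?_⟩
  have hg : IntegrableOn (fun s : ℝ => 2 * (s + 1) ^ (-(3/2) : ℝ)) (Ioi 0) :=
    (integrableOn_add_rpow_Ioi_of_lt (by norm_num) (by norm_num)).const_mul 2
  refine lt_of_le_of_lt (setLIntegral_mono' measurableSet_Ioi (g := fun s : ℝ =>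
    ENNReal.ofReal (2 * (s + 1) ^ (-(3/2) : ℝ))) ?_) hg.lintegral_lt_top
  intro s hs
  have hs0 : (0:ℝ) < s := hs
  apply ENNReal.ofReal_le_ofReal
  have hn : ‖ctrl s‖^2 = 1/(s+1)^2 := by
    rw [EuclideanSpace.norm_sq_eq]
    simp [ctrl, Fin.sum_univ_two, neg_div]
  have hb1 : 1/(s+1)^2 ≤ 1 := by
    rw [div_le_one (by positivity)]
    nlinarith
  have hb0 : 0 ≤ 1/(s+1)^2 := by positivity
  have hsq : 1 - 1/(s+1)^2 ≤ Real.sqrt (1 - 1/(s+1)^2) :=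
    Real.le_sqrt_of_sq_le (by nlinarith)
  have hpow : 1/(s+1)^2 ≤ (s+1) ^ (-(3/2) : ℝ) := by
    have : 1/(s+1)^2 = (s+1) ^ (-2 : ℝ) := by
      rw [Real.rpow_neg (by positivity)]
      norm_num
    rw [this]
    exact Real.rpow_le_rpow_of_exponent_le (by linarith) (by norm_num)
  have hnx : x s 1 ≤ ‖x s‖ := (le_abs_self _).trans (PiLp.norm_apply_le (x s) 1)
  have hexp : (s+1) ^ (3/2 : ℝ) ≤ Real.exp (2 * ‖x s‖) := by
    rw [Real.rpow_def_of_pos (by positivity)]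
    apply Real.exp_le_exp.2
    have := h1 s hs0.le
    linarith
  have hI1 : 1 / (1 + 3 * Real.exp (2 * ‖x s‖)) ≤ (s+1) ^ (-(3/2) : ℝ) := by
    rw [Real.rpow_neg (by positivity), ← one_div]
    apply one_div_le_one_div_of_le (by positivity)
    have := Real.exp_pos (2 * ‖x s‖)
    linarith
  rw [hn]
  have hIp : 3/4 ≤ Itilde (x s) := hI34 _
  have hIe := hI (x s)
  have hI1' : Itilde (x s) ≤ 1 := by
    rw [hIe]
    have : 0 ≤ 1 / (1 + 3 * Real.exp (2 * ‖x s‖)) := by positivity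
    linarith
  have ha : Itilde (x s) * (1 - 1/(s+1)^2) ≤ Itilde (x s) * Real.sqrt (1 - 1/(s+1)^2) :=
    mul_le_mul_of_nonneg_left hsq (by linarith)
  have hb : Itilde (x s) * (1/(s+1)^2) ≤ 1 * (1/(s+1)^2) :=
    mul_le_mul_of_nonneg_right hI1' hb0
  linarith
end
end
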